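/- arXiv:1906.00658 — 3 statements merged into one kernel-verified Lean document; each statement's English description precedes it below -/
import Mathlib

section
/- Let γ ∈ F_k with reduced word length t, and let n be an integer with n > t². Then: (1) if γ = 1, then |E[fix(φ_n(γ))] − 1| = n − 1; (2) if γ = γ₀^q for some γ₀ ∈ F_k and some integer q ≥ 2 which is maximal with this property (i.e. γ is not a q′-th power for any q′ > q), then |E[fix(φ_n(γ))] − 1| ≤ d(q) − 1 + t⁴/(n − t²); (3) if γ ≠ 1 and γ is not a proper power, then |E[fix(φ_n(γ))] − 1| ≤ t⁴/(n − t²). -/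
/-- The expected number of fixed points of `φ_n(γ)`, where `φ_n : F_k → Sym(n)` is the
random homomorphism determined by `k` independent uniform random permutations. -/
noncomputable def expFix (k n : ℕ) (γ : FreeGroup (Fin k)) : ℝ :=
  (∑ σ : Fin k → Equiv.Perm (Fin n),
      ((Finset.univ.filter fun i : Fin n => (FreeGroup.lift σ) γ i = i).card : ℝ)) /
    (Fintype.card (Fin k → Equiv.Perm (Fin n)) : ℝ)

namespace RandomPermWord

open Finset

variable {k n : ℕ}

/-- The inverse of a letter. -/
def letterInv (l : Fin k × Bool) : Fin k × Bool := (l.1, !l.2)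

/-- The permutation by which the inverse of a letter acts. -/
def act (σ : Fin k → Equiv.Perm (Fin n)) (l : Fin k × Bool) : Equiv.Perm (Fin n) :=
  cond l.2 (σ l.1)⁻¹ (σ l.1)

/-- The constraint `σ j a = b`, encoded as `(j, a, b)`, which says that the letter `l`
moves `x` to `y`. -/
def edge (l : Fin k × Bool) (x y : Fin n) : Fin k × Fin n × Fin n :=
  if l.2 then (l.1, y, x) else (l.1, x, y)

/-- The tuples of permutations satisfying a set of constraints. -/
def extending (P : Finset (Fin k × Fin n × Fin n)) : Finset (Fin k → Equiv.Perm (Fin n)) :=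
  univ.filter fun σ => ∀ e ∈ P, σ e.1 e.2.1 = e.2.2

theorem mem_extending {P : Finset (Fin k × Fin n × Fin n)} {σ : Fin k → Equiv.Perm (Fin n)} :
    σ ∈ extending P ↔ ∀ e ∈ P, σ e.1 e.2.1 = e.2.2 := by
  simp [extending]

theorem mem_extending_insert {P : Finset (Fin k × Fin n × Fin n)} {e : Fin k × Fin n × Fin n}
    {σ : Fin k → Equiv.Perm (Fin n)} :
    σ ∈ extending (insert e P) ↔ σ ∈ extending P ∧ σ e.1 e.2.1 = e.2.2 := by
  simp only [mem_extending, mem_insert, forall_eq_or_imp, and_comm]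

theorem act_letterInv (σ : Fin k → Equiv.Perm (Fin n)) (l : Fin k × Bool) :
    act σ (letterInv l) = (act σ l)⁻¹ := by
  rcases l with ⟨j, _ | _⟩ <;> simp [act, letterInv]

theorem letterInv_letterInv (l : Fin k × Bool) : letterInv (letterInv l) = l := by
  simp [letterInv]

theorem letterInv_ne (l : Fin k × Bool) : letterInv l ≠ l := by
  rcases l with ⟨j, _ | _⟩ <;> simp [letterInv]

theorem edge_sat_iff {σ : Fin k → Equiv.Perm (Fin n)} {l : Fin k × Bool} {x y : Fin n} :
    σ (edge l x y).1 (edge l x y).2.1 = (edge l x y).2.2 ↔ act σ l x = y := by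
  rcases l with ⟨j, _ | _⟩
  · simp [act, edge]
  · simp only [act, edge, cond_true, if_true, Equiv.Perm.inv_eq_iff_eq]
    exact eq_comm

theorem mem_extending_insert_edge {P : Finset (Fin k × Fin n × Fin n)}
    {l : Fin k × Bool} {x y : Fin n} {σ : Fin k → Equiv.Perm (Fin n)} :
    σ ∈ extending (insert (edge l x y) P) ↔ σ ∈ extending P ∧ act σ l x = y := by
  rw [mem_extending_insert, edge_sat_iff]

theorem card_extending_eq_sum (P : Finset (Fin k × Fin n × Fin n)) (l : Fin k × Bool) (x : Fin n) :
    (extending P).card = ∑ y, (extending (insert (edge l x y) P)).card := by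
  rw [card_eq_sum_card_fiberwise (t := univ) (f := fun σ => act σ l x) (by simp)]
  refine sum_congr rfl fun y _ => congrArg card ?_
  ext σ
  rw [mem_filter, mem_extending_insert_edge]

theorem extending_insert_eq_empty {P : Finset (Fin k × Fin n × Fin n)}
    {e e' : Fin k × Fin n × Fin n} (he' : e' ∈ P) (hne : e' ≠ e) (hj : e'.1 = e.1)
    (h : e'.2.1 = e.2.1 ∨ e'.2.2 = e.2.2) : extending (insert e P) = ∅ := by
  refine eq_empty_of_forall_notMem fun σ hσ => ?_
  rw [mem_extending_insert, mem_extending] at hσ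
  have h1 := hσ.1 e' he'
  have h2 := hσ.2
  obtain ⟨j, x, y⟩ := e
  obtain ⟨j', x', y'⟩ := e'
  simp only at h1 h2 hj h
  subst hj
  rcases h with rfl | rfl
  · exact hne (by rw [← h1, ← h2])
  · exact hne (by rw [(σ j').injective (h1.trans h2.symm)])

theorem card_extending_insert_le_swap {P : Finset (Fin k × Fin n × Fin n)} {j : Fin k}
    {x y : Fin n} (y' : Fin n) (hx : ∀ e ∈ P, e.1 = j → e.2.1 ≠ x)
    (hy : ∀ e ∈ P, e.1 = j → e.2.2 ≠ y) :
    (extending (insert (j, x, y') P)).card ≤ (extending (insert (j, x, y) P)).card := by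
  by_cases hy' : ∃ e ∈ P, e.1 = j ∧ e.2.2 = y'
  · obtain ⟨e, he, hj, hey⟩ := hy'
    rw [extending_insert_eq_empty he (fun h => hx e he hj (by rw [h])) hj (Or.inr hey)]
    simp
  · push Not at hy'
    refine card_le_card_of_injOn
      (fun σ => Function.update σ j (Equiv.swap y y' * σ j)) ?_ ?_
    · intro σ hσ
      rw [mem_coe, mem_extending_insert, mem_extending] at hσ
      rw [mem_coe, mem_extending_insert, mem_extending]
      refine ⟨fun e he => ?_, ?_⟩
      · dsimp only
        by_cases hj : e.1 = j
        · have h1 := hσ.1 e he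
          rw [hj] at h1
          rw [hj, Function.update_self, Equiv.Perm.mul_apply, h1,
            Equiv.swap_apply_of_ne_of_ne (hy e he hj) (hy' e he hj)]
        · rw [Function.update_of_ne hj, hσ.1 e he]
      · have h2 := hσ.2
        simp only at h2
        simp [h2]
    · intro σ _ τ _ h
      have h1 := congrFun h
      funext i
      by_cases hi : i = j
      · subst hi
        simpa using h1 i
      · simpa [hi] using h1 i

theorem mul_card_extending_insert_le {P : Finset (Fin k × Fin n × Fin n)}
    {e : Fin k × Fin n × Fin n} (he : e ∉ P) :
    (n - P.card) * (extending (insert e P)).card ≤ (extending P).card := by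
  by_cases h : ∃ e' ∈ P, e'.1 = e.1 ∧ (e'.2.1 = e.2.1 ∨ e'.2.2 = e.2.2)
  · obtain ⟨e', he', hj, h'⟩ := h
    rw [extending_insert_eq_empty he' (ne_of_mem_of_not_mem he' he) hj h']
    simp
  · push Not at h
    obtain ⟨j, x, y⟩ := e
    set R := P.image fun e => e.2.2
    calc (n - P.card) * (extending (insert (j, x, y) P)).card
        ≤ (univ \ R).card * (extending (insert (j, x, y) P)).card := by
          refine Nat.mul_le_mul_right _ ?_
          rw [card_univ_sdiff, Fintype.card_fin]
          exact Nat.sub_le_sub_left card_image_le _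
      _ = ∑ _z ∈ univ \ R, (extending (insert (j, x, y) P)).card := by simp
      _ ≤ ∑ z ∈ univ \ R, (extending (insert (j, x, z) P)).card := by
          refine sum_le_sum fun z hz => card_extending_insert_le_swap y ?_ ?_
          · exact fun e he hj => (h e he hj).1
          · intro e he _ hez
            exact (mem_sdiff.1 hz).2 (mem_image.2 ⟨e, he, hez⟩)
      _ ≤ ∑ z, (extending (insert (j, x, z) P)).card :=
          sum_le_sum_of_subset (subset_univ _)
      _ = (extending P).card := (card_extending_eq_sum P (j, false) x).symm

theorem card_extending_mul_descFactorial_le (P : Finset (Fin k × Fin n × Fin n)) :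
    (extending P).card * n.descFactorial P.card ≤
      Fintype.card (Fin k → Equiv.Perm (Fin n)) := by
  induction P using Finset.induction_on with
  | empty => simpa using card_le_univ (extending (k := k) (n := n) ∅)
  | insert e P he ih =>
    rw [card_insert_of_notMem he, Nat.descFactorial_succ]
    calc _ = ((n - P.card) * (extending (insert e P)).card) * n.descFactorial P.card := by ring
      _ ≤ _ := (Nat.mul_le_mul_right _ (mul_card_extending_insert_le he)).trans ih

theorem card_le_card_extending_mul_pow (P : Finset (Fin k × Fin n × Fin n))
    (hP : ∀ e ∈ P, ∀ e' ∈ P, e.1 = e'.1 → (e.2.1 = e'.2.1 ↔ e.2.2 = e'.2.2)) :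
    Fintype.card (Fin k → Equiv.Perm (Fin n)) ≤ (extending P).card * n ^ P.card := by
  induction P using Finset.induction_on with
  | empty => simp [extending, Fintype.card_pi]
  | insert e P he ih =>
    have ih := ih fun e he e' he' => hP e (mem_insert_of_mem he) e' (mem_insert_of_mem he')
    rw [card_insert_of_notMem he, pow_succ']
    obtain ⟨j, x, y⟩ := e
    have hx : ∀ e ∈ P, e.1 = j → e.2.1 ≠ x := by
      intro e he' hj hxe
      have := (hP e (mem_insert_of_mem he') _ (mem_insert_self _ _) hj).1 hxe
      refine he ?_
      simp only at this
      rwa [← hj, ← hxe, ← this]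
    have hy : ∀ e ∈ P, e.1 = j → e.2.2 ≠ y := by
      intro e he' hj hye
      exact hx e he' hj ((hP e (mem_insert_of_mem he') _ (mem_insert_self _ _) hj).2 hye)
    have key : (extending P).card ≤ n * (extending (insert (j, x, y) P)).card := by
      rw [card_extending_eq_sum P (j, false) x]
      calc _ ≤ ∑ _z : Fin n, (extending (insert (j, x, y) P)).card :=
            sum_le_sum fun z _ => card_extending_insert_le_swap z hx hy
        _ = _ := by simp
    calc _ ≤ (extending P).card * n ^ P.card := ih
      _ ≤ (n * (extending (insert (j, x, y) P)).card) * n ^ P.card :=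
          Nat.mul_le_mul_right _ key
      _ = _ := by ring

/-- The trajectory of `x` under the letters `W 0, W 1, …`. -/
def pos (σ : Fin k → Equiv.Perm (Fin n)) (W : ℕ → Fin k × Bool) (x : Fin n) : ℕ → Fin n
  | 0 => x
  | s + 1 => act σ (W s) (pos σ W x s)

/-- The points visited in the first `m` steps. -/
def verts (σ : Fin k → Equiv.Perm (Fin n)) (W : ℕ → Fin k × Bool) (x : Fin n) (m : ℕ) :
    Finset (Fin n) :=
  (range (m + 1)).image (pos σ W x)

/-- The constraints used in the first `m` steps. -/
def edges (σ : Fin k → Equiv.Perm (Fin n)) (W : ℕ → Fin k × Bool) (x : Fin n) (m : ℕ) :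
    Finset (Fin k × Fin n × Fin n) :=
  (range m).image fun s => edge (W s) (pos σ W x s) (pos σ W x (s + 1))

theorem pos_succ' (σ : Fin k → Equiv.Perm (Fin n)) (W : ℕ → Fin k × Bool) (x : Fin n) (s : ℕ) :
    pos σ W x (s + 1) = pos σ (fun i => W (i + 1)) (act σ (W 0) x) s := by
  induction s with
  | zero => rfl
  | succ s ih => rw [pos, ih, pos]

theorem range_succ_image {α : Type*} [DecidableEq α] (f : ℕ → α) (m : ℕ) :
    (range (m + 1)).image f = insert (f 0) ((range m).image fun s => f (s + 1)) := by
  ext a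
  simp only [mem_image, mem_range, mem_insert]
  constructor
  · rintro ⟨s, hs, rfl⟩
    rcases s with _ | s
    · exact Or.inl rfl
    · exact Or.inr ⟨s, by omega, rfl⟩
  · rintro (rfl | ⟨s, hs, rfl⟩)
    · exact ⟨0, by omega, rfl⟩
    · exact ⟨s + 1, by omega, rfl⟩

theorem verts_succ (σ : Fin k → Equiv.Perm (Fin n)) (W : ℕ → Fin k × Bool) (x : Fin n) (m : ℕ) :
    verts σ W x (m + 1) = insert x (verts σ (fun i => W (i + 1)) (act σ (W 0) x) m) := by
  rw [verts, range_succ_image, verts]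
  simp only [pos_succ']
  rfl

theorem edges_succ (σ : Fin k → Equiv.Perm (Fin n)) (W : ℕ → Fin k × Bool) (x : Fin n) (m : ℕ) :
    edges σ W x (m + 1) = insert (edge (W 0) x (act σ (W 0) x))
      (edges σ (fun i => W (i + 1)) (act σ (W 0) x) m) := by
  rw [edges, range_succ_image, edges]
  simp only [pos_succ']
  rfl

theorem mem_verts_self (σ : Fin k → Equiv.Perm (Fin n)) (W : ℕ → Fin k × Bool) (x : Fin n)
    (m : ℕ) : x ∈ verts σ W x m :=
  mem_image.2 ⟨0, by simp, rfl⟩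

/-- The tuples extending `P` for which, in the first `m` steps of the trajectory of `x`, the
number of new constraints exceeds the number of points outside of `V` by at least `c`. -/
def excess (P : Finset (Fin k × Fin n × Fin n)) (V : Finset (Fin n)) (W : ℕ → Fin k × Bool)
    (x : Fin n) (m c : ℕ) : Finset (Fin k → Equiv.Perm (Fin n)) :=
  (extending P).filter fun σ =>
    (V ∪ verts σ W x m).card + P.card + c ≤ (P ∪ edges σ W x m).card + V.card

theorem excess_subset (P : Finset (Fin k × Fin n × Fin n)) (V : Finset (Fin n))
    (W : ℕ → Fin k × Bool) (x : Fin n) (m c : ℕ) : excess P V W x m c ⊆ extending P :=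
  filter_subset _ _

theorem card_excess_succ (P : Finset (Fin k × Fin n × Fin n)) (V : Finset (Fin n))
    (W : ℕ → Fin k × Bool) (x : Fin n) (m c : ℕ) (hx : x ∈ V) :
    (excess P V W x (m + 1) c).card = ∑ y,
      ((extending (insert (edge (W 0) x y) P)).filter fun σ =>
        (insert y V ∪ verts σ (fun i => W (i + 1)) y m).card + P.card + c ≤
        (insert (edge (W 0) x y) P ∪ edges σ (fun i => W (i + 1)) y m).card + V.card).card := by
  rw [card_eq_sum_card_fiberwise (t := univ) (f := fun σ => act σ (W 0) x) (by simp)]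
  refine sum_congr rfl fun y _ => congrArg card ?_
  ext σ
  rw [mem_filter, excess, mem_filter, mem_filter, mem_extending_insert_edge, and_right_comm]
  refine and_congr_right fun hσ => ?_
  have hy := hσ.2
  rw [verts_succ, edges_succ, hy]
  have h1 : V ∪ insert x (verts σ (fun i => W (i + 1)) y m) =
      insert y V ∪ verts σ (fun i => W (i + 1)) y m := by
    have := mem_verts_self σ (fun i => W (i + 1)) y m
    ext a
    simp only [mem_union, mem_insert]
    constructor
    · rintro (h | rfl | h) <;> tauto
    · rintro ((rfl | h) | h) <;> tauto
  have h2 : P ∪ insert (edge (W 0) x y) (edges σ (fun i => W (i + 1)) y m) =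
      insert (edge (W 0) x y) P ∪ edges σ (fun i => W (i + 1)) y m := by
    rw [union_insert, insert_union]
  rw [h1, h2]

theorem card_excess_le {t : ℕ} (htn : t ≤ n) (m : ℕ) :
    ∀ (c : ℕ) (W : ℕ → Fin k × Bool) (P : Finset (Fin k × Fin n × Fin n)) (V : Finset (Fin n))
      (x : Fin n), x ∈ V → P.card + m ≤ t → V.card + m ≤ t + 1 →
      ((excess P V W x m c).card : ℝ) ≤
        (m * ((t : ℝ) / (n - t + 1))) ^ c * (extending P).card := by
  have hden : (0 : ℝ) < n - t + 1 := by
    have : (t : ℝ) ≤ n := by exact_mod_cast htn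
    linarith
  set p : ℝ := (t : ℝ) / (n - t + 1) with hp
  have hp0 : 0 ≤ p := by positivity
  induction m with
  | zero =>
    intro c W P V x hx _ _
    rcases c with _ | c
    · simpa using card_le_card (excess_subset P V W x _ 0)
    · have : excess P V W x 0 (c + 1) = ∅ := by
        refine filter_eq_empty_iff.2 fun σ _ => ?_
        have hV : V ∪ verts σ W x 0 = V := by simp [verts, pos, hx]
        have hP : P ∪ edges σ W x 0 = P := by simp [edges]
        rw [hV, hP]
        omega
      rw [this]
      simp
  | succ m ih =>
    intro c W P V x hx hPm hVm
    rcases c with _ | c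
    · simpa using card_le_card (excess_subset P V W x _ 0)
    · set N : ℝ := ((extending P).card : ℝ) with hN
      have hN0 : 0 ≤ N := by positivity
      have step : ∀ y, (((extending (insert (edge (W 0) x y) P)).filter fun σ =>
          (insert y V ∪ verts σ (fun i => W (i + 1)) y m).card + P.card + (c + 1) ≤
          (insert (edge (W 0) x y) P ∪ edges σ (fun i => W (i + 1)) y m).card + V.card).card : ℝ)
          ≤ (m * p) ^ (c + 1) * (extending (insert (edge (W 0) x y) P)).card +
            if y ∈ V then (m * p) ^ c * (N / (n - t + 1)) else 0 := by
        intro y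
        have hPc : (insert (edge (W 0) x y) P).card + m ≤ t := by
          have := card_insert_le (edge (W 0) x y) P
          omega
        have hVc : (insert y V).card + m ≤ t + 1 := by
          have := card_insert_le y V
          omega
        have IH := fun c' => ih c' (fun i => W (i + 1)) (insert (edge (W 0) x y) P) (insert y V) y
          (mem_insert_self _ _) hPc hVc
        have hextra : 0 ≤ if y ∈ V then (m * p) ^ c * (N / (n - t + 1)) else 0 := by
          split_ifs <;> positivity
        by_cases hnew : edge (W 0) x y ∉ P ∧ y ∈ V
        · obtain ⟨he, hy⟩ := hnew
          have h1 := mul_card_extending_insert_le he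
          have h2 : ((extending (insert (edge (W 0) x y) P)).card : ℝ) ≤ N / (n - t + 1) := by
            rw [le_div_iff₀ hden, hN]
            have h3 : (n - t + 1 : ℝ) ≤ ((n - P.card : ℕ) : ℝ) := by
              have : n + 1 ≤ (n - P.card) + t := by omega
              have : ((n + 1 : ℕ) : ℝ) ≤ ((n - P.card + t : ℕ) : ℝ) := by exact_mod_cast this
              push_cast at this ⊢
              linarith
            calc _ ≤ ((extending (insert (edge (W 0) x y) P)).card : ℝ) *
                  ((n - P.card : ℕ) : ℝ) := by gcongr
              _ ≤ _ := by rw [mul_comm]; exact_mod_cast h1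
          rw [if_pos hy]
          have h4 : (0 : ℝ) ≤ (m * p) ^ (c + 1) *
            (extending (insert (edge (W 0) x y) P)).card := by positivity
          refine le_trans ?_ (le_trans (IH c) (le_trans
            (mul_le_mul_of_nonneg_left h2 (by positivity)) (le_add_of_nonneg_left h4)))
          refine Nat.cast_le.2 (card_le_card (monotone_filter_right _ fun σ _ hσ => ?_))
          have hPc' := card_insert_of_notMem he
          have hVc' : (insert y V).card = V.card := by rw [insert_eq_of_mem hy]
          omega
        · refine le_trans ?_ (le_trans (IH (c + 1)) (le_add_of_nonneg_right hextra))
          refine Nat.cast_le.2 (card_le_card (monotone_filter_right _ fun σ _ hσ => ?_))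
          have hVc' : V.card ≤ (insert y V).card := card_le_card (subset_insert _ _)
          by_cases he : edge (W 0) x y ∈ P
          · have : (insert (edge (W 0) x y) P).card = P.card := by rw [insert_eq_of_mem he]
            omega
          · have hy : y ∉ V := fun hy => hnew ⟨he, hy⟩
            have h1 := card_insert_of_notMem hy
            have h2 := card_insert_of_notMem he
            omega
      rw [card_excess_succ P V W x m (c + 1) hx]
      push_cast
      calc _ ≤ _ := sum_le_sum fun y _ => step y
        _ = (m * p) ^ (c + 1) * N + V.card * ((m * p) ^ c * (N / (n - t + 1))) := by
          rw [sum_add_distrib, ← mul_sum, hN, card_extending_eq_sum P (W 0) x]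
          simp [sum_ite_mem]
        _ ≤ (m * p) ^ (c + 1) * N + t * ((m * p) ^ c * (N / (n - t + 1))) := by
          have : (V.card : ℝ) ≤ t := by exact_mod_cast (by omega : V.card ≤ t)
          gcongr
        _ = (m ^ c * (m + 1)) * (p ^ (c + 1) * N) := by
          have : N / (n - t + 1) * t = p * N := by rw [hp]; ring
          linear_combination (m * p) ^ c * this
        _ ≤ ((m + 1) ^ c * (m + 1)) * (p ^ (c + 1) * N) := by
          gcongr
          linarith
        _ = _ := by rw [mul_pow]; ring

theorem pos_add_of_eq {σ : Fin k → Equiv.Perm (Fin n)} {W : ℕ → Fin k × Bool} {x : Fin n}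
    {a b : ℕ} (hx : pos σ W x a = pos σ W x b) (hW : ∀ s, W (a + s) = W (b + s)) (s : ℕ) :
    pos σ W x (a + s) = pos σ W x (b + s) := by
  induction s with
  | zero => exact hx
  | succ s ih => rw [← add_assoc, ← add_assoc, pos, pos, ih, hW]

/-- The two half-edges (point, outgoing letter) belonging to a constraint. -/
def halfEdge (q : (Fin k × Fin n × Fin n) × Bool) : Fin n × Fin k × Bool :=
  if q.2 then (q.1.2.2, q.1.1, true) else (q.1.2.1, q.1.1, false)

theorem exists_halfEdge_source (l : Fin k × Bool) (x y : Fin n) :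
    ∃ b, halfEdge (edge l x y, b) = (x, l) := by
  rcases l with ⟨j, _ | _⟩
  · exact ⟨false, rfl⟩
  · exact ⟨true, rfl⟩

theorem exists_halfEdge_target (l : Fin k × Bool) (x y : Fin n) :
    ∃ b, halfEdge (edge l x y, b) = (y, letterInv l) := by
  rcases l with ⟨j, _ | _⟩
  · exact ⟨true, rfl⟩
  · exact ⟨false, rfl⟩

section Closed

variable {σ : Fin k → Equiv.Perm (Fin n)} {W : ℕ → Fin k × Bool} {x : Fin n} {t : ℕ}
  (ht : 0 < t) (hW : ∀ s, W (s + t) = W s) (hred : ∀ s, W (s + 1) ≠ letterInv (W s))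
  (hclosed : pos σ W x t = x)

include hW hclosed in
theorem pos_add_period (s : ℕ) : pos σ W x (s + t) = pos σ W x s := by
  have := pos_add_of_eq (σ := σ) (W := W) (x := x) (a := t) (b := 0) hclosed
    (fun s => by rw [add_comm, hW, zero_add]) s
  rwa [zero_add, add_comm] at this

theorem periodic_mod {α : Type*} {f : ℕ → α} {t : ℕ} (hf : ∀ s, f (s + t) = f s) (s : ℕ) :
    f (s % t) = f s :=
  Function.Periodic.map_mod_nat hf s

include ht hW hclosed in
theorem pos_mem_verts (s : ℕ) : pos σ W x s ∈ verts σ W x t := by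
  rw [← periodic_mod (pos_add_period hW hclosed) s]
  exact mem_image_of_mem _ (mem_range.2 (by have := Nat.mod_lt s ht; omega))

include ht hW hclosed in
theorem edge_mem_edges (s : ℕ) :
    edge (W s) (pos σ W x s) (pos σ W x (s + 1)) ∈ edges σ W x t := by
  have h : ∀ s, edge (W (s + t)) (pos σ W x (s + t)) (pos σ W x (s + t + 1)) =
      edge (W s) (pos σ W x s) (pos σ W x (s + 1)) := fun s => by
    rw [hW, pos_add_period hW hclosed, add_right_comm, pos_add_period hW hclosed]
  rw [← periodic_mod (f := fun s => edge (W s) (pos σ W x s) (pos σ W x (s + 1))) h s]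
  exact mem_image_of_mem (fun s => edge (W s) (pos σ W x s) (pos σ W x (s + 1)))
    (mem_range.2 (Nat.mod_lt s ht))

include ht hW hred hclosed in
/-- Every visited point has at least two half-edges; if there are not more constraints than
points, then it has exactly two. -/
theorem card_verts_le_and_halfEdges : (verts σ W x t).card ≤ (edges σ W x t).card ∧
    ((edges σ W x t).card ≤ (verts σ W x t).card → ∀ s r,
      pos σ W x (s + 1) = pos σ W x (r + 1) →
      (W (r + 1) = W (s + 1) ∨ W (r + 1) = letterInv (W s)) ∧
      (letterInv (W r) = W (s + 1) ∨ letterInv (W r) = letterInv (W s))) := by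
  set H := ((edges σ W x t) ×ˢ (univ : Finset Bool)).image halfEdge with hH
  have hHcard : H.card ≤ (edges σ W x t).card * 2 := by
    refine card_image_le.trans ?_
    rw [card_product, card_univ, Fintype.card_bool]
  have hout : ∀ s, (pos σ W x (s + 1), W (s + 1)) ∈ H := fun s => by
    obtain ⟨b, hb⟩ := exists_halfEdge_source (W (s + 1)) (pos σ W x (s + 1)) (pos σ W x (s + 2))
    exact mem_image.2 ⟨_, mem_product.2 ⟨edge_mem_edges ht hW hclosed (s + 1), mem_univ b⟩, hb⟩
  have hin : ∀ s, (pos σ W x (s + 1), letterInv (W s)) ∈ H := fun s => by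
    obtain ⟨b, hb⟩ := exists_halfEdge_target (W s) (pos σ W x s) (pos σ W x (s + 1))
    exact mem_image.2 ⟨_, mem_product.2 ⟨edge_mem_edges ht hW hclosed s, mem_univ b⟩, hb⟩
  let F : Fin n → Finset (Fin n × Fin k × Bool) := fun v => H.filter fun h => h.1 = v
  have hpair : ∀ s, {(pos σ W x (s + 1), W (s + 1)), (pos σ W x (s + 1), letterInv (W s))} ⊆
      F (pos σ W x (s + 1)) := fun s => by
    intro h hh
    rw [mem_insert, mem_singleton] at hh
    rcases hh with rfl | rfl
    · exact mem_filter.2 ⟨hout s, rfl⟩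
    · exact mem_filter.2 ⟨hin s, rfl⟩
  have hpaircard : ∀ s, ({(pos σ W x (s + 1), W (s + 1)),
      (pos σ W x (s + 1), letterInv (W s))} : Finset (Fin n × Fin k × Bool)).card = 2 :=
    fun s => card_pair fun h => hred s (Prod.ext_iff.1 h).2
  have hF : ∀ v ∈ verts σ W x t, 2 ≤ (F v).card := by
    intro v hv
    obtain ⟨s, _, rfl⟩ := mem_image.1 hv
    have h : pos σ W x s = pos σ W x (s + t - 1 + 1) := by
      rw [Nat.sub_add_cancel (by omega), pos_add_period hW hclosed]
    rw [h, ← hpaircard (s + t - 1)]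
    exact card_le_card (hpair _)
  have hsum : ∑ v ∈ verts σ W x t, (F v).card ≤ H.card := by
    rw [← card_biUnion]
    · exact card_le_card (biUnion_subset.2 fun v _ => filter_subset _ _)
    · intro a _ b _ hab
      exact disjoint_filter.2 fun h _ h1 h2 => hab (h1.symm.trans h2)
  have hsum2 : ∑ _v ∈ verts σ W x t, 2 ≤ ∑ v ∈ verts σ W x t, (F v).card := sum_le_sum hF
  have hconst : ∑ _v ∈ verts σ W x t, 2 = (verts σ W x t).card * 2 := by simp
  refine ⟨by omega, fun hle s r hsr => ?_⟩
  have heq : ∀ v ∈ verts σ W x t, 2 = (F v).card :=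
    (sum_eq_sum_iff_of_le hF).1 (by omega)
  have hFs := eq_of_subset_of_card_le (hpair s)
    (by rw [hpaircard, ← heq _ (pos_mem_verts ht hW hclosed _)])
  have hmem : (pos σ W x (s + 1), W (r + 1)) ∈ F (pos σ W x (s + 1)) :=
    mem_filter.2 ⟨hsr ▸ hout r, rfl⟩
  have hmem' : (pos σ W x (s + 1), letterInv (W r)) ∈ F (pos σ W x (s + 1)) :=
    mem_filter.2 ⟨hsr ▸ hin r, rfl⟩
  rw [← hFs, mem_insert, mem_singleton] at hmem hmem'
  exact ⟨by simpa using hmem, by simpa using hmem'⟩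

include ht hW hred hclosed in
theorem not_reversed (hle : (edges σ W x t).card ≤ (verts σ W x t).card) (g : ℕ) : ∀ s,
    pos σ W x (s + 1) = pos σ W x (s + g + 1) → W (s + g + 1) ≠ letterInv (W s) := by
  have dich := (card_verts_le_and_halfEdges ht hW hred hclosed).2 hle
  induction g using Nat.twoStepInduction with
  | zero => exact fun s _ => hred s
  | one =>
    intro s hs h
    rcases (dich _ _ hs.symm).1 with h1 | h1
    · exact hred s (h1.trans h)
    · exact letterInv_ne _ h1.symm
  | more g ih _ =>
    intro s hs h
    have h1 : W (s + 1) = letterInv (W (s + g + 2)) := by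
      rcases (dich _ _ hs.symm).1 with h1 | h1
      · exact absurd (h1.trans h) (hred s)
      · exact h1
    have hpos : pos σ W x (s + 1 + 1) = pos σ W x (s + 1 + g + 1) := by
      have h2 : pos σ W x (s + (g + 2) + 1) =
        act σ (W (s + g + 2)) (pos σ W x (s + g + 2)) := rfl
      rw [pos, hs, h2, h1, act_letterInv, Equiv.Perm.inv_def, Equiv.symm_apply_apply]
      congr 1
      omega
    refine ih (s + 1) hpos ?_
    rw [h1, letterInv_letterInv]
    congr 1
    omega

include ht hW hred hclosed in
theorem letters_eq (hle : (edges σ W x t).card ≤ (verts σ W x t).card) {s r : ℕ}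
    (hsr : pos σ W x (s + 1) = pos σ W x (r + 1)) : W (s + 1) = W (r + 1) ∧ W s = W r := by
  wlog hle' : s ≤ r generalizing s r
  · have := this hsr.symm (by omega)
    exact ⟨this.1.symm, this.2.symm⟩
  have dich := (card_verts_le_and_halfEdges ht hW hred hclosed).2 hle
  have nr := not_reversed ht hW hred hclosed hle
  obtain ⟨g, rfl⟩ := Nat.exists_eq_add_of_le hle'
  have h1 : W (s + g + 1) = W (s + 1) := by
    rcases (dich _ _ hsr).1 with h | h
    · exact h
    · exact absurd h (nr g s hsr)
  refine ⟨h1.symm, ?_⟩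
  rcases (dich _ _ hsr).2 with h | h
  · exact absurd (h1.trans h.symm) (hred _)
  · rw [← letterInv_letterInv (W s), ← h, letterInv_letterInv]

include ht hW hred hclosed in
theorem exists_period (hle : (edges σ W x t).card ≤ (verts σ W x t).card) :
    ∃ d ∈ t.divisors, (∀ s, W (s + d) = W s) ∧ (∀ s, pos σ W x (s + d) = pos σ W x s) ∧
      Set.InjOn (pos σ W x) (Set.Iio d) ∧ (edges σ W x t).card = d := by
  have hposp := pos_add_period hW hclosed
  have hsucc : ∀ s, ∃ s', s + t = s' + 1 := fun s => ⟨s + t - 1, by omega⟩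
  have hlet : ∀ s r, pos σ W x s = pos σ W x r → W s = W r := by
    intro s r h
    obtain ⟨s', hs'⟩ := hsucc s
    obtain ⟨r', hr'⟩ := hsucc r
    rw [← hW s, ← hW r, hs', hr']
    rw [← hposp s, ← hposp r, hs', hr'] at h
    exact (letters_eq ht hW hred hclosed hle h).1
  have hfwd : ∀ s r, pos σ W x s = pos σ W x r → pos σ W x (s + 1) = pos σ W x (r + 1) := by
    intro s r h
    rw [pos, pos, h, hlet s r h]
  have hbwd : ∀ s r, pos σ W x (s + 1) = pos σ W x (r + 1) → pos σ W x s = pos σ W x r := by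
    intro s r h
    have h' := (letters_eq ht hW hred hclosed hle h).2
    rw [pos, pos, h'] at h
    exact (act σ (W r)).injective h
  have hback : ∀ s g, pos σ W x s = pos σ W x (g + s) → pos σ W x g = x := by
    intro s
    induction s with
    | zero => exact fun g h => h.symm
    | succ s ih => exact fun g h => ih g (hbwd _ _ h)
  have hex : ∃ d, 0 < d ∧ pos σ W x d = x := ⟨t, ht, hclosed⟩
  obtain ⟨hd0, hd⟩ := Nat.find_spec hex
  have hmin := fun m (hm : m < Nat.find hex) => Nat.find_min hex hm
  set d := Nat.find hex
  have hper : ∀ s, pos σ W x (s + d) = pos σ W x s := by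
    intro s
    induction s with
    | zero => rw [zero_add, hd]; rfl
    | succ s ih => rw [add_right_comm]; exact hfwd _ _ ih
  have hdvd : ∀ g, pos σ W x g = x → d ∣ g := by
    intro g hg
    by_contra h
    have h1 : 0 < g % d := Nat.pos_of_ne_zero fun h0 => h (Nat.dvd_of_mod_eq_zero h0)
    exact hmin _ (Nat.mod_lt g hd0) ⟨h1, by rw [periodic_mod hper, hg]⟩
  have hinj : Set.InjOn (pos σ W x) (Set.Iio d) := by
    intro s hs r hr h
    wlog hsr : s ≤ r generalizing s r
    · exact (this hr hs h.symm (by omega)).symm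
    obtain ⟨g, rfl⟩ := Nat.exists_eq_add_of_le hsr
    have := hdvd g (hback s g (by rw [h, add_comm]))
    have hg : g < d := by
      have : s + g < d := hr
      omega
    rw [Nat.eq_zero_of_dvd_of_lt this hg, add_zero]
  have hverts : verts σ W x t = (range d).image (pos σ W x) := by
    ext v
    constructor
    · intro hv
      obtain ⟨s, _, rfl⟩ := mem_image.1 hv
      rw [← periodic_mod hper s]
      exact mem_image_of_mem _ (mem_range.2 (Nat.mod_lt s hd0))
    · intro hv
      obtain ⟨s, _, rfl⟩ := mem_image.1 hv
      exact pos_mem_verts ht hW hclosed s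
  have hcard : (verts σ W x t).card = d := by
    rw [hverts, card_image_of_injOn, card_range]
    intro a ha b hb hab
    exact hinj (by simpa using ha) (by simpa using hb) hab
  refine ⟨d, Nat.mem_divisors.2 ⟨hdvd t hclosed, ht.ne'⟩, fun s => hlet _ _ (hper s), hper, hinj,
    ?_⟩
  have := (card_verts_le_and_halfEdges ht hW hred hclosed).1
  omega

end Closed

/-- The constraints saying that the letters `W 0, …, W (d - 1)` move the points
`f 0, …, f (d - 1)` around in a cycle. -/
def cycleEdges {d : ℕ} [NeZero d] (W : ℕ → Fin k × Bool) (f : Fin d → Fin n) :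
    Finset (Fin k × Fin n × Fin n) :=
  univ.image fun s : Fin d => edge (W s) (f s) (f (s + 1))

theorem card_cycleEdges_le {d : ℕ} [NeZero d] (W : ℕ → Fin k × Bool) (f : Fin d → Fin n) :
    (cycleEdges W f).card ≤ d := by
  simpa [cycleEdges] using
    card_image_le (s := univ) (f := fun s : Fin d => edge (W s) (f s) (f (s + 1)))

theorem card_filter_injective (d n : ℕ) :
    (univ.filter fun f : Fin d → Fin n => Function.Injective f).card = n.descFactorial d := by
  rw [← Fintype.card_subtype, Fintype.card_congr (Equiv.subtypeInjectiveEquivEmbedding _ _),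
    Fintype.card_embedding_eq, Fintype.card_fin, Fintype.card_fin]

theorem apply_val_add_one {α : Type*} {d : ℕ} [NeZero d] {g : ℕ → α}
    (hg : ∀ s, g (s + d) = g s) (s : Fin d) : g ((s + 1 : Fin d) : ℕ) = g (s + 1) := by
  rw [Fin.val_add, periodic_mod hg]
  rcases Nat.lt_or_ge 1 d with h | h
  · rw [Fin.val_one', Nat.mod_eq_of_lt h]
  · have hd : d = 1 := le_antisymm h (Nat.one_le_iff_ne_zero.2 (NeZero.ne d))
    subst hd
    rw [Fin.val_one', Nat.mod_self, hg s, add_zero]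

/-- Pairs `(σ, x)` such that the trajectory of `x` is periodic with period `d`, is injective on a
period, and uses exactly `d` constraints in `t` steps. -/
def periodPairs (W : ℕ → Fin k × Bool) (t d : ℕ) :
    Set ((Fin k → Equiv.Perm (Fin n)) × Fin n) :=
  {p | (∀ s, pos p.1 W p.2 (s + d) = pos p.1 W p.2 s) ∧
    Set.InjOn (pos p.1 W p.2) (Set.Iio d) ∧ (edges p.1 W p.2 t).card = d}

open scoped Classical in
theorem card_periodPairs_le {W : ℕ → Fin k × Bool} {t d : ℕ} (hd : 0 < d) (hdn : d ≤ n)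
    (hW : ∀ s, W (s + d) = W s) :
    (univ.filter fun p => p ∈ periodPairs (n := n) W t d).card ≤
      Fintype.card (Fin k → Equiv.Perm (Fin n)) := by
  have : NeZero d := ⟨hd.ne'⟩
  set N := Fintype.card (Fin k → Equiv.Perm (Fin n))
  set T := (univ.filter fun f : Fin d → Fin n =>
    Function.Injective f ∧ (cycleEdges W f).card = d).sigma
    fun f => extending (cycleEdges W f)
  have h1 : (univ.filter fun p => p ∈ periodPairs (n := n) W t d).card ≤ T.card := by
    refine card_le_card_of_injOn (fun p => ⟨fun s => pos p.1 W p.2 s, p.1⟩) ?_ ?_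
    · rintro ⟨σ, x⟩ hp
      obtain ⟨hper, hinj, hcard⟩ : _ ∧ _ ∧ _ := (mem_filter.1 (mem_coe.1 hp)).2
      have hsucc := apply_val_add_one hper
      dsimp only at hper hinj hcard hsucc
      refine mem_coe.2 (mem_sigma.2 ⟨mem_filter.2 ⟨mem_univ _, ?_, ?_⟩, ?_⟩)
      · exact fun a b hab => Fin.ext (hinj a.2 b.2 hab)
      · refine le_antisymm (card_cycleEdges_le _ _) ?_
        refine hcard.symm.le.trans (card_le_card fun e he => ?_)
        obtain ⟨s, _, rfl⟩ := mem_image.1 he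
        refine mem_image.2 ⟨⟨s % d, Nat.mod_lt s hd⟩, mem_univ _, ?_⟩
        have h : ∀ s, edge (W (s + d)) (pos σ W x (s + d)) (pos σ W x (s + d + 1)) =
            edge (W s) (pos σ W x s) (pos σ W x (s + 1)) := fun s => by
          rw [hW, hper, add_right_comm, hper]
        dsimp only
        rw [hsucc]
        exact periodic_mod (f := fun s => edge (W s) (pos σ W x s) (pos σ W x (s + 1))) h s
      · rw [mem_extending]
        intro e he
        obtain ⟨s, _, rfl⟩ := mem_image.1 he
        rw [edge_sat_iff]
        exact (hsucc s).symm
    · rintro ⟨σ, x⟩ _ ⟨τ, y⟩ _ h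
      simp only [Sigma.mk.injEq, heq_eq_eq] at h
      exact Prod.ext h.2 (congrFun h.1 0)
  refine h1.trans ?_
  have hpos : 0 < n.descFactorial d := Nat.pos_of_ne_zero fun h =>
    absurd (Nat.descFactorial_eq_zero_iff_lt.1 h) (by omega)
  refine Nat.le_of_mul_le_mul_right ?_ hpos
  rw [card_sigma, sum_mul]
  calc _ ≤ ∑ _f ∈ univ.filter (fun f : Fin d → Fin n =>
        Function.Injective f ∧ (cycleEdges W f).card = d), N := by
        refine sum_le_sum fun f hf => ?_
        have := card_extending_mul_descFactorial_le (cycleEdges W f)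
        rwa [(mem_filter.1 hf).2.2] at this
    _ ≤ ∑ _f ∈ univ.filter (fun f : Fin d → Fin n => Function.Injective f), N :=
        sum_le_sum_of_subset (monotone_filter_right _ fun f _ hf => hf.1)
    _ = N * n.descFactorial d := by
        rw [sum_const, smul_eq_mul, card_filter_injective, mul_comm]

/-- Pairs `(σ, x)` such that the trajectory of `x` returns to `x` after `t` steps. -/
def closedPairs (W : ℕ → Fin k × Bool) (t : ℕ) :
    Finset ((Fin k → Equiv.Perm (Fin n)) × Fin n) :=
  univ.filter fun p => pos p.1 W p.2 t = p.2

section Bounds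

variable {W : ℕ → Fin k × Bool} {t : ℕ} (ht : 0 < t) (htn : t ≤ n)
  (hW : ∀ s, W (s + t) = W s) (hred : ∀ s, W (s + 1) ≠ letterInv (W s))

open scoped Classical in
include ht htn hW hred in
theorem card_closedPairs_le : ((closedPairs (n := n) W t).card : ℝ) ≤
    ((t.divisors.filter fun d => ∀ s, W (s + d) = W s).card +
      n * (t * ((t : ℝ) / (n - t + 1))) ^ 2) *
      Fintype.card (Fin k → Equiv.Perm (Fin n)) := by
  set N := Fintype.card (Fin k → Equiv.Perm (Fin n)) with hN
  set D := t.divisors.filter fun d => ∀ s, W (s + d) = W s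
  set A : Finset ((Fin k → Equiv.Perm (Fin n)) × Fin n) :=
    D.biUnion fun d => univ.filter fun p => p ∈ periodPairs (n := n) W t d
  set B : Finset ((Fin k → Equiv.Perm (Fin n)) × Fin n) :=
    univ.biUnion fun x => (excess ∅ {x} W x t 2).image fun σ => (σ, x)
  have hsub : closedPairs W t ⊆ A ∪ B := by
    rintro ⟨σ, x⟩ hp
    have hclosed : pos σ W x t = x := (mem_filter.1 hp).2
    rw [mem_union]
    by_cases hle : (edges σ W x t).card ≤ (verts σ W x t).card
    · left
      obtain ⟨d, hd, h1, h2, h3, h4⟩ := exists_period ht hW hred hclosed hle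
      exact mem_biUnion.2 ⟨d, mem_filter.2 ⟨hd, h1⟩, mem_filter.2 ⟨mem_univ _, h2, h3, h4⟩⟩
    · right
      refine mem_biUnion.2 ⟨x, mem_univ _, mem_image.2 ⟨σ, mem_filter.2 ⟨?_, ?_⟩, rfl⟩⟩
      · simp [mem_extending]
      · rw [empty_union, singleton_union, insert_eq_of_mem (mem_verts_self σ W x t)]
        simp only [card_empty, card_singleton]
        omega
  have hA : A.card ≤ D.card * N := by
    refine card_biUnion_le_card_mul _ _ _ fun d hd => ?_
    obtain ⟨h1, h2⟩ := mem_filter.1 hd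
    exact card_periodPairs_le (Nat.pos_of_mem_divisors h1)
      ((Nat.divisor_le h1).trans htn) h2
  have hB : (B.card : ℝ) ≤ n * ((t * ((t : ℝ) / (n - t + 1))) ^ 2 * N) := by
    calc (B.card : ℝ) ≤ ((∑ x : Fin n, (excess ∅ {x} W x t 2).card : ℕ) : ℝ) :=
          Nat.cast_le.2 (card_biUnion_le.trans (sum_le_sum fun x _ => card_image_le))
      _ ≤ ∑ _x : Fin n, (t * ((t : ℝ) / (n - t + 1))) ^ 2 * N := by
          rw [Nat.cast_sum]
          refine sum_le_sum fun x _ => ?_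
          have := card_excess_le htn t 2 W ∅ {x} x (mem_singleton_self x) (by simp)
            (by simp [add_comm])
          simpa [extending, hN, Fintype.card_pi] using this
      _ = _ := by simp
  calc ((closedPairs (n := n) W t).card : ℝ) ≤ ((A.card + B.card : ℕ) : ℝ) :=
        Nat.cast_le.2 ((card_le_card hsub).trans (card_union_le _ _))
    _ ≤ ((D.card * N : ℕ) : ℝ) + n * ((t * ((t : ℝ) / (n - t + 1))) ^ 2 * N) := by
        rw [Nat.cast_add]
        exact add_le_add (Nat.cast_le.2 hA) hB
    _ = _ := by push_cast; ring

include hW hred in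
theorem cycleEdges_consistent [NeZero t] {f : Fin t → Fin n} (hf : Function.Injective f) :
    ∀ e ∈ cycleEdges W f, ∀ e' ∈ cycleEdges W f, e.1 = e'.1 →
      (e.2.1 = e'.2.1 ↔ e.2.2 = e'.2.2) := by
  have hred' : ∀ s : Fin t, W (s + 1 : Fin t) ≠ letterInv (W s) := fun s => by
    rw [apply_val_add_one hW]
    exact hred s
  have key : ∀ s r : Fin t, (W s).2 = false → (W r).2 = true → (W s).1 = (W r).1 →
      f s ≠ f (r + 1) ∧ f (s + 1) ≠ f r := by
    intro s r hs hr hsr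
    refine ⟨fun h => hred' r ?_, fun h => hred' s ?_⟩
    · rw [← hf h]
      exact Prod.ext hsr (by simp [letterInv, hs, hr])
    · rw [hf h]
      exact Prod.ext hsr.symm (by simp [letterInv, hs, hr])
  intro e he e' he' hj
  obtain ⟨s, _, rfl⟩ := mem_image.1 he
  obtain ⟨r, _, rfl⟩ := mem_image.1 he'
  cases hs : (W s).2 <;> cases hr : (W r).2 <;>
    simp only [edge, hs, hr, if_true, if_false, Bool.false_eq_true] at hj ⊢
  · rw [hf.eq_iff, hf.eq_iff, add_left_inj]
  · have := key s r hs hr hj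
    exact iff_of_false this.1 this.2
  · have := key r s hr hs hj.symm
    exact iff_of_false (Ne.symm this.1) (Ne.symm this.2)
  · rw [hf.eq_iff, hf.eq_iff, add_left_inj]

include ht htn hW hred in
theorem mul_descFactorial_le_card_closedPairs :
    Fintype.card (Fin k → Equiv.Perm (Fin n)) * n.descFactorial t ≤
      (closedPairs (n := n) W t).card * n ^ t := by
  have : NeZero t := ⟨ht.ne'⟩
  set T := (univ.filter fun f : Fin t → Fin n => Function.Injective f).sigma
    fun f => extending (cycleEdges W f)
  have hpos : ∀ p ∈ T, ∀ s : ℕ, pos p.2 W (p.1 0) s = p.1 (Fin.ofNat t s) := by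
    rintro ⟨f, σ⟩ hp s
    have hσ := mem_extending.1 (mem_sigma.1 hp).2
    induction s with
    | zero => simp [pos]
    | succ s ih =>
      have h := hσ _ (mem_image_of_mem _ (mem_univ (Fin.ofNat t s)))
      rw [edge_sat_iff] at h
      dsimp only at ih h ⊢
      have h2 : Fin.ofNat t (s + 1) = Fin.ofNat t s + 1 := by
        ext
        simp [Fin.val_add]
      rw [pos, ih, h2, ← h, Fin.val_ofNat, periodic_mod hW]
  have h1 : T.card ≤ (closedPairs (n := n) W t).card := by
    refine card_le_card_of_injOn (fun p => (p.2, p.1 0)) ?_ ?_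
    · intro p hp
      refine mem_coe.2 (mem_filter.2 ⟨mem_univ _, ?_⟩)
      dsimp only
      rw [hpos p hp t]
      simp
    · rintro ⟨f, σ⟩ hp ⟨g, τ⟩ hq h
      simp only [Prod.mk.injEq] at h
      obtain ⟨rfl, h0⟩ := h
      have : f = g := by
        funext s
        have h1 := hpos _ hp s
        have h2 := hpos _ hq s
        rw [Fin.ofNat_val_eq_self] at h1 h2
        dsimp only at h1 h2
        rw [← h1, ← h2, h0]
      rw [this]
  have hn : 0 < n := by omega
  calc _ = ∑ f : Fin t → Fin n with Function.Injective f,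
        Fintype.card (Fin k → Equiv.Perm (Fin n)) := by
        rw [sum_const, smul_eq_mul, card_filter_injective, mul_comm]
    _ ≤ ∑ f : Fin t → Fin n with Function.Injective f,
        (extending (cycleEdges W f)).card * n ^ t := by
        refine sum_le_sum fun f hf => ?_
        refine (card_le_card_extending_mul_pow _
          (cycleEdges_consistent hW hred (mem_filter.1 hf).2)).trans ?_
        exact Nat.mul_le_mul_left _ (Nat.pow_le_pow_right hn (card_cycleEdges_le W f))
    _ = T.card * n ^ t := by rw [← sum_mul, card_sigma]
    _ ≤ _ := Nat.mul_le_mul_right _ h1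

end Bounds

/-- The word formed by the first `m` letters of a sequence. -/
def word (W : ℕ → Fin k × Bool) (m : ℕ) : List (Fin k × Bool) :=
  (List.range m).map W

theorem pos_eq_lift_inv (σ : Fin k → Equiv.Perm (Fin n)) (W : ℕ → Fin k × Bool) (x : Fin n)
    (m : ℕ) : pos σ W x m = (FreeGroup.lift σ (FreeGroup.mk (word W m)))⁻¹ x := by
  induction m with
  | zero => simp [pos, word]
  | succ m ih =>
    have h : FreeGroup.mk (word W (m + 1)) = FreeGroup.mk (word W m) * FreeGroup.mk [W m] := by
      rw [FreeGroup.mul_mk, word, List.range_succ, List.map_append]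
      rfl
    rw [pos, ih, h, map_mul, mul_inv_rev, Equiv.Perm.mul_apply]
    congr 1
    rcases W m with ⟨j, _ | _⟩ <;> simp [act]

theorem expFix_mk_word (W : ℕ → Fin k × Bool) (t : ℕ) :
    expFix k n (FreeGroup.mk (word W t)) =
      (closedPairs (n := n) W t).card / (Fintype.card (Fin k → Equiv.Perm (Fin n)) : ℝ) := by
  rw [expFix, closedPairs, ← Nat.cast_sum]
  congr 2
  rw [card_filter, ← univ_product_univ, sum_product]
  refine sum_congr rfl fun σ _ => ?_
  rw [card_filter]
  refine sum_congr rfl fun x _ => ?_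
  simp only [pos_eq_lift_inv, Equiv.Perm.inv_eq_iff_eq, eq_comm (a := x)]

theorem expFix_conj (g h : FreeGroup (Fin k)) : expFix k n (g * h * g⁻¹) = expFix k n h := by
  rw [expFix, expFix]
  congr 1
  refine sum_congr rfl fun σ _ => ?_
  congr 1
  refine card_equiv (FreeGroup.lift σ g)⁻¹ fun x => ?_
  simp [Equiv.eq_symm_apply]

theorem period_gcd {α : Type*} {f : ℕ → α} (a b : ℕ) (ha : ∀ s, f (s + a) = f s)
    (hb : ∀ s, f (s + b) = f s) : ∀ s, f (s + Nat.gcd a b) = f s := by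
  induction a, b using Nat.gcd.induction with
  | H0 b => simpa using hb
  | H1 a b _ ih =>
    rw [Nat.gcd_rec]
    refine ih (fun s => ?_) ha
    rw [← periodic_mod ha (s + b % a), Nat.add_mod_mod, periodic_mod ha, hb]

theorem word_mul {W : ℕ → Fin k × Bool} {d : ℕ} (hW : ∀ s, W (s + d) = W s) (m : ℕ) :
    word W (m * d) = (List.replicate m (word W d)).flatten := by
  induction m with
  | zero => simp [word]
  | succ m ih =>
    rw [List.replicate_succ, List.flatten_cons, ← ih, Nat.succ_mul, add_comm, word,
      List.range_add, List.map_append, List.map_map]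
    congr 1
    exact List.map_congr_left fun s _ => by rw [Function.comp_apply, add_comm, hW]

theorem mk_word_mul {W : ℕ → Fin k × Bool} {d : ℕ} (hW : ∀ s, W (s + d) = W s) (m : ℕ) :
    FreeGroup.mk (word W (m * d)) = FreeGroup.mk (word W d) ^ m := by
  rw [word_mul hW, FreeGroup.pow_mk]

open scoped Classical in
/-- If `q` is maximal such that the word of length `q * d₀` is a `q`-th power, then its periods
correspond to divisors of `q`. -/
theorem card_periods_le {W : ℕ → Fin k × Bool} {d₀ q : ℕ} (hd₀ : 0 < d₀) (hq : 0 < q)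
    (hW : ∀ s, W (s + d₀) = W s)
    (hmax : ∀ q' : ℕ, q < q' →
      ¬ ∃ γ₁ : FreeGroup (Fin k), FreeGroup.mk (word W (q * d₀)) = γ₁ ^ q') :
    ((q * d₀).divisors.filter fun d => ∀ s, W (s + d) = W s).card ≤ q.divisors.card := by
  have key : ∀ d, d ∣ q * d₀ → (∀ s, W (s + d) = W s) → d₀ ∣ d := by
    intro d hd hWd
    have hg := period_gcd d d₀ hWd hW
    obtain ⟨m, hm⟩ := Nat.gcd_dvd_right d d₀
    have hm1 : m ≤ 1 := by
      by_contra hm1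
      refine hmax (q * m) (lt_mul_of_one_lt_right hq (by omega))
        ⟨FreeGroup.mk (word W (Nat.gcd d d₀)), ?_⟩
      rw [← mk_word_mul hg]
      congr 2
      rw [mul_assoc, mul_comm m, ← hm]
    have hm0 : m ≠ 0 := by
      rintro rfl
      rw [mul_zero] at hm
      omega
    have hm' : m = 1 := by omega
    rw [hm', mul_one] at hm
    rw [hm]
    exact Nat.gcd_dvd_left d d₀
  refine card_le_card_of_injOn (fun d => d / d₀) ?_ ?_
  · intro d hd
    obtain ⟨h1, h2⟩ := mem_filter.1 (mem_coe.1 hd)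
    have h1 := Nat.dvd_of_mem_divisors h1
    obtain ⟨e, rfl⟩ := key d h1 h2
    dsimp only
    rw [Nat.mul_div_cancel_left _ hd₀]
    refine mem_coe.2 (Nat.mem_divisors.2 ⟨?_, hq.ne'⟩)
    rw [mul_comm d₀] at h1
    exact Nat.dvd_of_mul_dvd_mul_right hd₀ h1
  · intro d hd e he h
    obtain ⟨h1, h2⟩ := mem_filter.1 (mem_coe.1 hd)
    obtain ⟨h3, h4⟩ := mem_filter.1 (mem_coe.1 he)
    exact (Nat.div_left_inj (key d (Nat.dvd_of_mem_divisors h1) h2)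
      (key e (Nat.dvd_of_mem_divisors h3) h4)).1 h

theorem abs_expFix_mk_word_sub_one_le {W : ℕ → Fin k × Bool} {d₀ q t : ℕ} (hd₀ : 0 < d₀)
    (hq : 0 < q) (ht : t = q * d₀) (hn : t ^ 2 < n) (hW : ∀ s, W (s + d₀) = W s)
    (hred : ∀ s, W (s + 1) ≠ letterInv (W s))
    (hmax : ∀ q' : ℕ, q < q' →
      ¬ ∃ γ₁ : FreeGroup (Fin k), FreeGroup.mk (word W t) = γ₁ ^ q') :
    |expFix k n (FreeGroup.mk (word W t)) - 1| ≤
      (q.divisors.card : ℝ) - 1 + (t : ℝ) ^ 4 / ((n : ℝ) - (t : ℝ) ^ 2) := by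
  classical
  have ht0 : 0 < t := by rw [ht]; positivity
  have htn : t ≤ n := by nlinarith
  have hWt : ∀ s, W (s + t) = W s := by
    intro s
    have h : s + t = s + q * d₀ := by rw [ht]
    rw [h, ← periodic_mod hW, Nat.add_mul_mod_self_right, periodic_mod hW]
  have hup := card_closedPairs_le ht0 htn hWt hred
  have hlow := mul_descFactorial_le_card_closedPairs ht0 htn hWt hred
  have hD : (t.divisors.filter fun d => ∀ s, W (s + d) = W s).card ≤ q.divisors.card := by
    subst ht
    exact card_periods_le hd₀ hq hW hmax
  have hq1 : (1 : ℝ) ≤ q.divisors.card := by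
    exact_mod_cast card_pos.2 ⟨1, Nat.one_mem_divisors.2 hq.ne'⟩
  rw [expFix_mk_word]
  set N := Fintype.card (Fin k → Equiv.Perm (Fin n))
  have hN : (0 : ℝ) < N := by exact_mod_cast Fintype.card_pos
  set A := (closedPairs (n := n) W t).card
  have ht1 : (1 : ℝ) ≤ t := by exact_mod_cast ht0
  have hnR : (t : ℝ) ^ 2 < n := by exact_mod_cast hn
  have htnR : (t : ℝ) ≤ n := by exact_mod_cast htn
  have hn0 : (0 : ℝ) < n := by linarith
  have hden : (0 : ℝ) < n - t + 1 := by linarith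
  have hden' : (0 : ℝ) < n - (t : ℝ) ^ 2 := by linarith
  have hDR : ((t.divisors.filter fun d => ∀ s, W (s + d) = W s).card : ℝ) ≤ q.divisors.card := by
    exact_mod_cast hD
  rw [abs_le]
  constructor
  · have h1 : (1 : ℝ) - (t : ℝ) ^ 2 / n ≤ A / N := by
      have h2 : (N : ℝ) * ((n : ℝ) + 1 - t) ^ t ≤ A * (n : ℝ) ^ t := by
        have h3 := (Nat.mul_le_mul_left N (Nat.pow_sub_le_descFactorial n t)).trans hlow
        have h4 : ((n + 1 - t : ℕ) : ℝ) = (n : ℝ) + 1 - t := by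
          rw [Nat.cast_sub (by omega)]
          push_cast
          ring
        rw [← h4]
        exact_mod_cast h3
      have h5 : (1 : ℝ) - (t : ℝ) ^ 2 / n ≤ (((n : ℝ) + 1 - t) / n) ^ t := by
        have hb := one_add_mul_le_pow (a := ((1 : ℝ) - t) / n) (by
          rw [le_div_iff₀ hn0]
          linarith) t
        have h6 : (1 : ℝ) + (1 - t) / n = ((n : ℝ) + 1 - t) / n := by
          field_simp
          ring
        rw [h6] at hb
        refine le_trans ?_ hb
        have h7 : (t : ℝ) * ((1 - t) / n) = t / n - (t : ℝ) ^ 2 / n := by ring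
        rw [h7]
        have : (0 : ℝ) ≤ t / n := by positivity
        linarith
      refine h5.trans ?_
      rw [div_pow, div_le_div_iff₀ (by positivity) hN]
      linarith
    have h8 : (t : ℝ) ^ 2 / n ≤ (t : ℝ) ^ 4 / (n - (t : ℝ) ^ 2) := by
      refine div_le_div₀ (by positivity) ?_ hden' (by nlinarith)
      exact pow_le_pow_right₀ ht1 (by norm_num)
    linarith
  · have h1 : (A : ℝ) / N ≤ q.divisors.card + n * (t * ((t : ℝ) / (n - t + 1))) ^ 2 := by
      rw [div_le_iff₀ hN]
      refine hup.trans ?_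
      gcongr
    have h2 : n * (t * ((t : ℝ) / (n - t + 1))) ^ 2 ≤ (t : ℝ) ^ 4 / (n - (t : ℝ) ^ 2) := by
      have h3 : n * (t * ((t : ℝ) / (n - t + 1))) ^ 2 =
          (t : ℝ) ^ 4 * n / (n - t + 1) ^ 2 := by
        field_simp
      rw [h3, div_le_div_iff₀ (by positivity) hden', mul_assoc]
      refine mul_le_mul_of_nonneg_left ?_ (by positivity)
      nlinarith [mul_nonneg hn0.le (sq_nonneg ((t : ℝ) - 1)), sq_nonneg ((t : ℝ) - 1)]
    linarith

theorem abs_expFix_sub_one_le {γ γ₀ : FreeGroup (Fin k)} {q : ℕ} (hq : 0 < q)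
    (hγ : γ = γ₀ ^ q) (hγ1 : γ ≠ 1)
    (hmax : ∀ q' : ℕ, q < q' → ¬ ∃ γ₁ : FreeGroup (Fin k), γ = γ₁ ^ q')
    (hn : γ.toWord.length ^ 2 < n) :
    |expFix k n γ - 1| ≤ (q.divisors.card : ℝ) - 1 +
      (γ.toWord.length : ℝ) ^ 4 / ((n : ℝ) - (γ.toWord.length : ℝ) ^ 2) := by
  set c := FreeGroup.reduceCyclically γ₀.toWord with hc
  set C := FreeGroup.reduceCyclically.conjugator γ₀.toWord with hC
  have hcyc : FreeGroup.IsCyclicallyReduced c :=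
    FreeGroup.reduceCyclically.isCyclicallyReduced FreeGroup.isReduced_toWord
  have hconj : γ₀ = FreeGroup.mk C * FreeGroup.mk c * (FreeGroup.mk C)⁻¹ := by
    rw [FreeGroup.inv_mk, FreeGroup.mul_mk, FreeGroup.mul_mk, hC, hc,
      FreeGroup.reduceCyclically.conj_conjugator_reduceCyclically, FreeGroup.mk_toWord]
  have hc0 : 0 < c.length := by
    rw [List.length_pos_iff]
    intro h
    refine hγ1 ?_
    rw [hγ, hconj, h, ← FreeGroup.one_eq_mk, mul_one, mul_inv_cancel, one_pow]
  let W : ℕ → Fin k × Bool := fun s => c.get ⟨s % c.length, Nat.mod_lt s hc0⟩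
  have hW : ∀ s, W (s + c.length) = W s := fun s => by simp [W]
  have hwc : word W c.length = c := by
    refine List.ext_getElem (by simp [word]) fun i h1 h2 => ?_
    simp [word, W, Nat.mod_eq_of_lt h2]
  have hred : ∀ s, W (s + 1) ≠ letterInv (W s) := by
    intro s h
    have hr := (hcyc.flatten_replicate (s + 2)).isReduced
    nth_rw 1 [← hwc] at hr
    rw [← word_mul hW, FreeGroup.IsReduced, List.isChain_iff_getElem] at hr
    have hlen : s + 1 < (word W ((s + 2) * c.length)).length := by
      simp only [word, List.length_map, List.length_range]
      nlinarith
    have := hr s hlen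
    simp only [word, List.getElem_map, List.getElem_range, h, letterInv] at this
    simp at this
  have hγconj : γ = FreeGroup.mk C * FreeGroup.mk (word W (q * c.length)) *
      (FreeGroup.mk C)⁻¹ := by
    rw [mk_word_mul hW, hwc, hγ, hconj, conj_pow]
  have hlen : q * c.length ≤ γ.toWord.length := by
    rw [hγ, FreeGroup.toWord_pow,
      FreeGroup.reduceCyclically.reduce_flatten_replicate FreeGroup.isReduced_toWord, if_neg hq.ne',
      ← hc]
    simp
    omega
  set T := γ.toWord.length
  have hlen2 : (q * c.length) ^ 2 ≤ T ^ 2 := Nat.pow_le_pow_left hlen 2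
  have hmain := abs_expFix_mk_word_sub_one_le (n := n) hc0 hq rfl (by omega) hW hred (by
    rintro q' hq' ⟨γ₁, h⟩
    exact hmax q' hq' ⟨FreeGroup.mk C * γ₁ * (FreeGroup.mk C)⁻¹, by rw [hγconj, h, conj_pow]⟩)
  rw [hγconj, expFix_conj]
  refine hmain.trans (add_le_add le_rfl ?_)
  have hR : ((q * c.length : ℕ) : ℝ) ≤ T := by exact_mod_cast hlen
  have hnR : (T : ℝ) ^ 2 < n := by exact_mod_cast hn
  refine div_le_div₀ (by positivity) ?_ (by linarith) ?_ <;> gcongr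

end RandomPermWord

/-- Broder–Shamir, Puder: two-sided estimates for
`E[fix(φ_n(γ))] − 1 = E[Tr ρ_n⁰(γ)]` where `t` is the reduced word length of `γ` and
`n > t²`. -/
theorem stmt_11 (k : ℕ) (hk : 2 ≤ k) (γ : FreeGroup (Fin k)) (t : ℕ)
    (ht : t = (FreeGroup.toWord γ).length) (n : ℕ) (hn : t ^ 2 < n) :
    (γ = 1 → |expFix k n γ - 1| = (n : ℝ) - 1) ∧
    (∀ (γ₀ : FreeGroup (Fin k)) (q : ℕ), 2 ≤ q → γ = γ₀ ^ q →
      (∀ q' : ℕ, q < q' → ¬ ∃ γ₁ : FreeGroup (Fin k), γ = γ₁ ^ q') →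
      |expFix k n γ - 1| ≤
        (q.divisors.card : ℝ) - 1 + (t : ℝ) ^ 4 / ((n : ℝ) - (t : ℝ) ^ 2)) ∧
    (γ ≠ 1 → (¬ ∃ (γ₀ : FreeGroup (Fin k)) (q : ℕ), 2 ≤ q ∧ γ = γ₀ ^ q) →
      |expFix k n γ - 1| ≤ (t : ℝ) ^ 4 / ((n : ℝ) - (t : ℝ) ^ 2)) := by
  subst ht
  refine ⟨?_, ?_, ?_⟩
  · rintro rfl
    have hn1 : (1 : ℝ) ≤ n := by exact_mod_cast (by omega : 1 ≤ n)
    have h : expFix k n 1 = n := by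
      simp only [expFix, map_one, Equiv.Perm.one_apply, Finset.filter_true, Finset.card_univ,
        Fintype.card_fin, Finset.sum_const, nsmul_eq_mul]
      rw [mul_comm, mul_div_assoc, div_self (Nat.cast_ne_zero.2 Fintype.card_ne_zero), mul_one]
    rw [h, abs_of_nonneg (by linarith)]
  · intro γ₀ q hq hγ hmax
    refine RandomPermWord.abs_expFix_sub_one_le (by omega) hγ ?_ hmax hn
    rintro rfl
    exact hmax (q + 1) (by omega) ⟨1, (one_pow _).symm⟩
  · intro hγ1 hnp
    have := RandomPermWord.abs_expFix_sub_one_le (γ₀ := γ) one_pos (pow_one γ).symm hγ1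
      (fun q' hq' ⟨γ₁, h⟩ => hnp ⟨γ₁, q', hq', h⟩) hn
    simpa using this
end

section
/- For every integer k ≥ 2 there exists a constant C(k) > 0 such that for every n ≥ 1, if σ₁,…,σ_k are independent random permutations, each uniformly distributed on Sym(n), then the probability that the subgroup of Sym(n) generated by σ₁,…,σ_k acts transitively on {1,…,n} is at least 1 − C(k)/n^{k−1}. -/
open scoped Pointwise

theorem Equiv.Perm.choose_mul_card_stabilizer_finset {α : Type*} [Fintype α] [DecidableEq α]
    (A : Finset α) :
    (Fintype.card α).choose A.card * Nat.card (MulAction.stabilizer (Equiv.Perm α) A) =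
      (Fintype.card α).factorial := by
  have := Set.powersetCard.isPretransitive (α := α) (n := A.card)
  let s : Set.powersetCard α A.card := ⟨A, rfl⟩
  have hi := MulAction.index_stabilizer_of_transitive (Equiv.Perm α) s
  have hm := (MulAction.stabilizer (Equiv.Perm α) s).index_mul_card
  rw [hi, Set.powersetCard.stabilizer_coe, Set.powersetCard.card, Nat.card_eq_fintype_card,
    Nat.card_eq_fintype_card (α := Equiv.Perm α), Fintype.card_perm] at hm
  rw [← MulAction.stabilizer_coe_finset]
  exact hm

theorem Nat.self_le_choose {n a : ℕ} (ha : 1 ≤ a) (han : a + 1 ≤ n) : n ≤ n.choose a := by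
  induction n generalizing a with
  | zero => simp
  | succ n ih =>
    obtain ⟨b, rfl⟩ := Nat.exists_eq_add_of_le' ha
    rw [Nat.choose_succ_succ']
    rcases Nat.lt_or_ge (b + 1) n with h | h
    · have := ih ha h
      have : 0 < n.choose b := Nat.choose_pos (by omega)
      omega
    · obtain rfl : n = b + 1 := by omega
      simp [add_comm]

theorem Nat.choose_two_le_choose {n a : ℕ} (ha : 2 ≤ a) (han : a + 2 ≤ n) :
    n.choose 2 ≤ n.choose a := by
  induction n generalizing a with
  | zero => simp
  | succ n ih =>
    rcases Nat.lt_or_ge (a + 1) n with h | h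
    · obtain ⟨b, rfl⟩ := Nat.exists_eq_add_of_le' ha
      have h1 := ih ha h
      have h2 : n ≤ n.choose (b + 1) := Nat.self_le_choose (by omega) (by omega)
      rw [Nat.choose_succ_succ n (b + 1), Nat.choose_succ_succ n 1, Nat.choose_one_right]
      exact add_le_add h2 h1
    · obtain rfl : n = a + 1 := by omega
      rw [← Nat.choose_symm_add (a := a) (b := 2)]

theorem sum_div_choose_le_four (n : ℕ) :
    ∑ a ∈ Finset.Ioo 0 n, (n : ℝ) / n.choose a ≤ 4 := by
  rcases Nat.lt_or_ge n 2 with hn | hn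
  · rw [Finset.sum_eq_zero fun a ha ↦ by rw [Finset.mem_Ioo] at ha; omega]
    norm_num
  have hn1 : (0 : ℝ) < (n : ℝ) - 1 := by
    have : (2 : ℝ) ≤ n := by exact_mod_cast hn
    linarith
  have hterm : ∀ a ∈ Finset.Ioo 0 n, (n : ℝ) / n.choose a ≤
      2 / ((n : ℝ) - 1) + ((if a = 1 then 1 else 0) + if a = n - 1 then 1 else 0) := by
    intro a ha
    rw [Finset.mem_Ioo] at ha
    have hpos : (0 : ℝ) < n.choose a := by exact_mod_cast Nat.choose_pos ha.2.le
    have h0 : (0 : ℝ) ≤ 2 / ((n : ℝ) - 1) := by positivity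
    by_cases h : a = 1 ∨ a = n - 1
    · have h1 : (n : ℝ) / n.choose a ≤ 1 := by
        rw [div_le_one hpos]
        exact_mod_cast Nat.self_le_choose ha.1 ha.2
      have h2 : (1 : ℝ) ≤ (if a = 1 then 1 else 0) + if a = n - 1 then 1 else 0 := by
        rcases h with h | h <;> rw [if_pos h] <;> split_ifs <;> norm_num
      linarith
    · push Not at h
      rw [if_neg h.1, if_neg h.2, add_zero, add_zero, div_le_div_iff₀ hpos hn1]
      have hc : ((n.choose 2 : ℕ) : ℝ) ≤ n.choose a := by
        exact_mod_cast Nat.choose_two_le_choose (by omega) (by omega)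
      rw [Nat.cast_choose_two] at hc
      linarith
  refine (Finset.sum_le_sum hterm).trans ?_
  rw [Finset.sum_add_distrib, Finset.sum_add_distrib, Finset.sum_const, Nat.card_Ioo,
    Finset.sum_ite_eq', Finset.sum_ite_eq', if_pos (by simp; omega), if_pos (by simp; omega),
    nsmul_eq_mul, Nat.sub_zero, Nat.cast_sub (by omega), Nat.cast_one, mul_div_cancel₀ _ hn1.ne']
  norm_num

theorem sum_inv_choose_pow_le (n : ℕ) {m : ℕ} (hm : m ≠ 0) :
    ∑ a ∈ Finset.Ioo 0 n, (1 : ℝ) / (n.choose a : ℝ) ^ m ≤ 4 / (n : ℝ) ^ m := by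
  rcases Nat.eq_zero_or_pos n with rfl | hn
  · simp [hm]
  have hnm : (0 : ℝ) < (n : ℝ) ^ m := by positivity
  rw [le_div_iff₀ hnm, Finset.sum_mul]
  refine (Finset.sum_le_sum fun a ha ↦ ?_).trans (sum_div_choose_le_four n)
  rw [Finset.mem_Ioo] at ha
  have hpos : (0 : ℝ) < n.choose a := by exact_mod_cast Nat.choose_pos ha.2.le
  rw [one_div_mul_eq_div, ← div_pow]
  refine pow_le_of_le_one (by positivity) ?_ hm
  rw [div_le_one hpos]
  exact_mod_cast Nat.self_le_choose ha.1 ha.2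

theorem exists_invariant_finset_of_not_transitive {α ι : Type*} [Fintype α] [DecidableEq α]
    {σ : ι → Equiv.Perm α}
    (h : ¬ ∀ i j : α, ∃ g ∈ Subgroup.closure (Set.range σ), g i = j) :
    ∃ A : Finset α, 0 < A.card ∧ A.card < Fintype.card α ∧
      ∀ t, σ t ∈ MulAction.stabilizer (Equiv.Perm α) A := by
  classical
  push Not at h
  obtain ⟨i, j, hij⟩ := h
  let A : Finset α := {x | ∃ g ∈ Subgroup.closure (Set.range σ), g i = x}
  refine ⟨A, Finset.card_pos.2 ⟨i, ?_⟩, Finset.card_lt_univ_of_notMem (x := j) ?_, fun t ↦ ?_⟩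
  · simpa [A] using ⟨1, one_mem _, rfl⟩
  · simpa [A] using hij
  · have ht : σ t ∈ Subgroup.closure (Set.range σ) := Subgroup.subset_closure ⟨t, rfl⟩
    rw [MulAction.mem_stabilizer_iff]
    refine Finset.eq_of_subset_of_card_le (fun x hx ↦ ?_) (by simp)
    obtain ⟨y, hy, rfl⟩ := Finset.mem_smul_finset.1 hx
    obtain ⟨g, hg, rfl⟩ : ∃ g ∈ Subgroup.closure (Set.range σ), g i = y := by simpa [A] using hy
    simpa [A] using ⟨σ t * g, mul_mem ht hg, rfl⟩

theorem ncard_not_transitive_le (n k : ℕ) :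
    ({σ : Fin k → Equiv.Perm (Fin n) |
        ∀ i j : Fin n, ∃ g ∈ Subgroup.closure (Set.range σ), g i = j}ᶜ).ncard ≤
      ∑ A : Finset (Fin n) with 0 < A.card ∧ A.card < n,
        Nat.card (MulAction.stabilizer (Equiv.Perm (Fin n)) A) ^ k := by
  classical
  let S (A : Finset (Fin n)) : Finset (Fin k → Equiv.Perm (Fin n)) :=
    Fintype.piFinset fun _ ↦ {g | g ∈ MulAction.stabilizer (Equiv.Perm (Fin n)) A}
  have hS (A : Finset (Fin n)) :
      (S A).card = Nat.card (MulAction.stabilizer (Equiv.Perm (Fin n)) A) ^ k := by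
    rw [Fintype.card_piFinset_const, Nat.card_eq_fintype_card, ← Fintype.card_subtype]
  simp_rw [← hS]
  refine le_trans ?_ Finset.card_biUnion_le
  rw [← Set.ncard_coe_finset]
  refine Set.ncard_le_ncard (fun σ hσ ↦ ?_) (Finset.finite_toSet _)
  obtain ⟨A, h0, h1, h2⟩ := exists_invariant_finset_of_not_transitive hσ
  rw [Fintype.card_fin] at h1
  rw [Finset.mem_coe, Finset.mem_biUnion]
  exact ⟨A, by simp [h1, Finset.card_pos.1 h0], by simpa [S] using h2⟩

theorem sum_card_stabilizer_pow (n m : ℕ) :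
    ∑ A : Finset (Fin n) with 0 < A.card ∧ A.card < n,
        (Nat.card (MulAction.stabilizer (Equiv.Perm (Fin n)) A) : ℝ) ^ (m + 1) =
      (n.factorial : ℝ) ^ (m + 1) *
        ∑ a ∈ Finset.Ioo 0 n, (1 : ℝ) / (n.choose a : ℝ) ^ m := by
  have hA (A : Finset (Fin n)) : (Nat.card (MulAction.stabilizer (Equiv.Perm (Fin n)) A) : ℝ) =
      (n.factorial : ℝ) / n.choose A.card := by
    have hpos : (0 : ℝ) < n.choose A.card := by
      exact_mod_cast Nat.choose_pos (by simpa using A.card_le_univ)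
    rw [eq_div_iff hpos.ne', mul_comm]
    have := Equiv.Perm.choose_mul_card_stabilizer_finset A
    rw [Fintype.card_fin] at this
    exact_mod_cast this
  simp_rw [hA]
  rw [Finset.sum_filter, ← Finset.powerset_univ, Finset.sum_powerset_apply_card
    (fun a ↦ if 0 < a ∧ a < n then ((n.factorial : ℝ) / n.choose a) ^ (m + 1) else 0),
    Finset.card_univ, Fintype.card_fin, Finset.mul_sum]
  simp_rw [smul_ite, smul_zero]
  rw [← Finset.sum_filter]
  refine Finset.sum_congr (by ext a; simp; omega) fun a ha ↦ ?_
  have hpos : (0 : ℝ) < n.choose a := by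
    exact_mod_cast Nat.choose_pos (Finset.mem_Ioo.1 ha).2.le
  rw [nsmul_eq_mul, div_pow, pow_succ (n.choose a : ℝ)]
  field_simp


/-- for every `k ≥ 2` there is `C(k) > 0` such that for every `n ≥ 1`,
the probability that `k` independent uniform random permutations of `{1,…,n}` generate a
transitive subgroup of `Sym(n)` is at least `1 − C(k)/n^{k−1}`. -/
theorem stmt_12 (k : ℕ) (hk : 2 ≤ k) :
    ∃ C : ℝ, 0 < C ∧
      ∀ n : ℕ, 1 ≤ n →
        (1 : ℝ) - C / (n : ℝ) ^ (k - 1) ≤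
          ((Set.ncard {σ : Fin k → Equiv.Perm (Fin n) |
              ∀ i j : Fin n, ∃ g ∈ Subgroup.closure (Set.range σ), g i = j}) : ℝ) /
            (Fintype.card (Fin k → Equiv.Perm (Fin n)) : ℝ) := by
  obtain ⟨m, rfl⟩ : ∃ m, k = m + 1 := ⟨k - 1, by omega⟩
  refine ⟨4, by norm_num, fun n _ ↦ ?_⟩
  rw [Nat.add_sub_cancel]
  set T : Set (Fin (m + 1) → Equiv.Perm (Fin n)) :=
    {σ | ∀ i j : Fin n, ∃ g ∈ Subgroup.closure (Set.range σ), g i = j}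
  have hcard : (Fintype.card (Fin (m + 1) → Equiv.Perm (Fin n)) : ℝ) =
      (n.factorial : ℝ) ^ (m + 1) := by
    rw [Fintype.card_pi_const, Fintype.card_perm, Fintype.card_fin, Nat.cast_pow]
  have hadd : (T.ncard : ℝ) + (Tᶜ.ncard : ℝ) = (n.factorial : ℝ) ^ (m + 1) := by
    rw [← hcard, ← Nat.card_eq_fintype_card]
    exact_mod_cast Set.ncard_add_ncard_compl T
  have hbad : (Tᶜ.ncard : ℝ) ≤ (n.factorial : ℝ) ^ (m + 1) * (4 / (n : ℝ) ^ m) := by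
    have h : (Tᶜ.ncard : ℝ) ≤ ∑ A : Finset (Fin n) with 0 < A.card ∧ A.card < n,
        (Nat.card (MulAction.stabilizer (Equiv.Perm (Fin n)) A) : ℝ) ^ (m + 1) := by
      exact_mod_cast ncard_not_transitive_le n (m + 1)
    rw [sum_card_stabilizer_pow] at h
    exact h.trans (by gcongr; exact sum_inv_choose_pow_le n (by omega))
  rw [hcard, le_div_iff₀ (by positivity)]
  linarith
end

section
/- The encoding map 𝒲 → SL₂(ℝ), 𝐚 ↦ γ_𝐚, is injective. Consequently, Γ is a free group with free basis {γ₁,…,γ_r}: the homomorphism from the free group on r generators to SL₂(ℝ) sending the j-th free generator to γ_j (1 ≤ j ≤ r) is injective. -/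
open MeasureTheory

/-- `SL(2,ℝ)`. -/
abbrev SL2 : Type := Matrix.SpecialLinearGroup (Fin 2) ℝ

/-- The Möbius transformation of `g ∈ SL(2,ℝ)` acting on `ℂ` (junk at the pole). -/
noncomputable def mobiusC (g : SL2) (z : ℂ) : ℂ :=
  ((g.1 0 0 : ℂ) * z + (g.1 0 1 : ℂ)) / ((g.1 1 0 : ℂ) * z + (g.1 1 1 : ℂ))

/-- The Möbius transformation of `g ∈ SL(2,ℝ)` acting on `ℝ` (junk at the pole). -/
noncomputable def mobiusR (g : SL2) (x : ℝ) : ℝ :=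
  (g.1 0 0 * x + g.1 0 1) / (g.1 1 0 * x + g.1 1 1)

/-- The derivative `γ'(z) = (uz+v)⁻²` of the Möbius transformation of `g`. -/
noncomputable def mobiusDerivC (g : SL2) (z : ℂ) : ℂ :=
  ((g.1 1 0 : ℂ) * z + (g.1 1 1 : ℂ))⁻¹ ^ 2

/-- The derivative `γ'(x) = (ux+v)⁻²` of the Möbius transformation of `g`, real version. -/
noncomputable def mobiusDerivR (g : SL2) (x : ℝ) : ℝ :=
  (g.1 1 0 * x + g.1 1 1)⁻¹ ^ 2

/-- The Möbius transformation of `g ∈ SL(2,ℝ)` acting on the Riemann sphere `ℂ ∪ {∞}`. -/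
noncomputable def mobiusS (g : SL2) (z : OnePoint ℂ) : OnePoint ℂ :=
  Option.elim z
    (if (g.1 1 0 : ℝ) = 0 then OnePoint.infty else (((g.1 0 0 / g.1 1 0 : ℝ) : ℂ) : OnePoint ℂ))
    (fun w => if ((g.1 1 0 : ℂ) * w + (g.1 1 1 : ℂ)) = 0 then OnePoint.infty
      else ((mobiusC g w : ℂ) : OnePoint ℂ))

/-- The involution `a ↦ ā = a + r mod 2r` on the alphabet `𝒜 = Fin (2r)`. -/
def wordBar {r : ℕ} (a : Fin (2 * r)) : Fin (2 * r) :=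
  ⟨(a.1 + r) % (2 * r), Nat.mod_lt _ (Nat.lt_of_le_of_lt (Nat.zero_le _) a.isLt)⟩

/-- A word: a finite sequence of letters with no adjacent letter equal to the bar of the
previous one. -/
def IsWord {r : ℕ} (w : List (Fin (2 * r))) : Prop :=
  w.Chain' (fun x y => x ≠ wordBar y)

/-- The mirror word `𝐚̄ = (ā_n, …, ā_1)`. -/
def mirror {r : ℕ} (w : List (Fin (2 * r))) : List (Fin (2 * r)) :=
  (w.map wordBar).reverse

/-- `𝐚 → 𝐛` : either word is empty, or the last letter of `𝐚` is not the bar of the first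
letter of `𝐛`. -/
def arrow {r : ℕ} (w v : List (Fin (2 * r))) : Prop :=
  ∀ x ∈ w.getLast?, ∀ y ∈ v.head?, x ≠ wordBar y

/-- `𝐚 ⇝ 𝐛` : both words are nonempty and the last letter of `𝐚` equals the first letter
of `𝐛`. -/
def wiggly {r : ℕ} (w v : List (Fin (2 * r))) : Prop :=
  w ≠ [] ∧ v ≠ [] ∧ w.getLast? = v.head?

/-- Schottky data: pairwise disjoint closed discs centered on the real line, paired by
elements of `SL(2,ℝ)`. -/
structure Schottky where
  r : ℕ
  two_le_r : 2 ≤ r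
  center : Fin (2 * r) → ℝ
  radius : Fin (2 * r) → ℝ
  radius_pos : ∀ a, 0 < radius a
  g : Fin (2 * r) → SL2
  disjoint : ∀ a b : Fin (2 * r), a ≠ b →
    Disjoint (closure (Metric.ball ((center a : ℂ)) (radius a)))
             (closure (Metric.ball ((center b : ℂ)) (radius b)))
  g_bar : ∀ a : Fin (2 * r), g (wordBar a) = (g a)⁻¹
  maps : ∀ a : Fin (2 * r),
    mobiusS (g a) '' (((fun w : ℂ => (w : OnePoint ℂ)) ''
        Metric.ball ((center (wordBar a) : ℂ)) (radius (wordBar a)))ᶜ)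
      = (fun w : ℂ => (w : OnePoint ℂ)) '' closure (Metric.ball ((center a : ℂ)) (radius a))

namespace Schottky

variable (S : Schottky)

/-- The open disc `D_a`. -/
def D (a : Fin (2 * S.r)) : Set ℂ := Metric.ball ((S.center a : ℂ)) (S.radius a)

/-- The union `𝐃` of the open discs. -/
def Dall : Set ℂ := ⋃ a, S.D a

/-- The open interval `I_a = D_a ∩ ℝ`. -/
def Ireal (a : Fin (2 * S.r)) : Set ℝ := {x : ℝ | (x : ℂ) ∈ S.D a}

/-- The union `I` of the intervals `I_a`. -/
def Iall : Set ℝ := ⋃ a, S.Ireal a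

/-- The group element `γ_𝐚 = γ_{a₁} ⋯ γ_{a_n}` associated to a word. -/
noncomputable def wprod (w : List (Fin (2 * S.r))) : SL2 := (w.map S.g).prod

/-- The Schottky group `Γ`, generated by the `γ_a`. -/
def SGroup : Subgroup SL2 := Subgroup.closure (Set.range S.g)

theorem wprod_mem (w : List (Fin (2 * S.r))) : S.wprod w ∈ S.SGroup := by
  apply Subgroup.list_prod_mem
  intro x hx
  obtain ⟨a, -, rfl⟩ := List.mem_map.mp hx
  exact Subgroup.subset_closure ⟨a, rfl⟩

/-- `γ_𝐚` as an element of the Schottky group `Γ`. -/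
noncomputable def wprodG (w : List (Fin (2 * S.r))) : S.SGroup := ⟨S.wprod w, S.wprod_mem w⟩

/-- The generator `γ_a` as an element of `Γ`. -/
noncomputable def genG (a : Fin (2 * S.r)) : S.SGroup :=
  ⟨S.g a, Subgroup.subset_closure ⟨a, rfl⟩⟩

/-- The interval `I_𝐚 = γ_{𝐚'}(I_{a_n})` of a nonempty word. -/
noncomputable def Iset (w : List (Fin (2 * S.r))) : Set ℝ :=
  if h : w = [] then ∅ else mobiusR (S.wprod w.dropLast) '' S.Ireal (w.getLast h)

/-- `Υ_𝐚 = |I_𝐚|`, the length of the interval `I_𝐚`; `Υ_∅ = 1`. -/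
noncomputable def ups (w : List (Fin (2 * S.r))) : ℝ :=
  if w = [] then 1 else (volume (S.Iset w)).toReal

/-- The Bourgain–Dyatlov partition `Z(τ)`. -/
def Zset (τ : ℝ) : Set (List (Fin (2 * S.r))) :=
  {w | IsWord w ∧ w ≠ [] ∧ S.ups w ≤ τ ∧ τ < S.ups w.dropLast}

/-- The mirror set `Z̄(τ) = {𝐚 ∈ 𝒲 : 𝐚̄ ∈ Z(τ)}`. -/
def Zbar (τ : ℝ) : Set (List (Fin (2 * S.r))) :=
  {w | IsWord w ∧ mirror w ∈ S.Zset τ}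

open Classical in
/-- The Bowen–Series map on the Riemann sphere (junk value `∞` off `𝐃`). -/
noncomputable def TS (z : OnePoint ℂ) : OnePoint ℂ :=
  if h : ∃ a : Fin (2 * S.r), ∃ w : ℂ, z = (w : OnePoint ℂ) ∧ w ∈ S.D a
  then mobiusS (S.g h.choose)⁻¹ z
  else OnePoint.infty

/-- The limit set `Λ`: points of `𝐃` all of whose forward iterates under the Bowen–Series
map are defined (finite) and remain in `𝐃`. -/
def limitSet : Set ℂ :=
  {z : ℂ | ∀ n : ℕ, ∃ w : ℂ, (S.TS)^[n] (z : OnePoint ℂ) = (w : OnePoint ℂ) ∧ w ∈ S.Dall}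

/-- The limit set, viewed inside `ℝ`. -/
def limitSetR : Set ℝ := {x : ℝ | (x : ℂ) ∈ S.limitSet}

/-- `δ`, the Hausdorff dimension of the limit set. -/
noncomputable def delta : ℝ := (dimH S.limitSet).toReal

/-- `PowerPairs(τ)`: pairs `(𝐚,𝐛) ∈ Z̄(τ)²` such that `γ_{𝐚'}γ_{𝐛'}⁻¹` is a nontrivial
proper power in `Γ`. -/
def PowerPairs (τ : ℝ) : Set (List (Fin (2 * S.r)) × List (Fin (2 * S.r))) :=
  {p | p.1 ∈ S.Zbar τ ∧ p.2 ∈ S.Zbar τ ∧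
    S.wprod p.1.dropLast * (S.wprod p.2.dropLast)⁻¹ ≠ 1 ∧
    ∃ γ₀ ∈ S.SGroup, ∃ q : ℕ, 2 ≤ q ∧
      S.wprod p.1.dropLast * (S.wprod p.2.dropLast)⁻¹ = (γ₀ : SL2) ^ q}

end Schottky

/-- The Möbius action is compatible with products at the point `∞`. -/
theorem mobiusS_mul_infty (g h : SL2) :
    mobiusS (g * h) OnePoint.infty = mobiusS g (mobiusS h OnePoint.infty) := by
  have hdet : ∀ k : SL2, k.1 0 0 * k.1 1 1 - k.1 0 1 * k.1 1 0 = 1 := fun k => by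
    rw [← Matrix.det_fin_two]; exact k.2
  have hg := hdet g
  have hh := hdet h
  have e00 : (g * h).1 0 0 = g.1 0 0 * h.1 0 0 + g.1 0 1 * h.1 1 0 := by
    simp [Matrix.mul_apply, Fin.sum_univ_two]
  have e10 : (g * h).1 1 0 = g.1 1 0 * h.1 0 0 + g.1 1 1 * h.1 1 0 := by
    simp [Matrix.mul_apply, Fin.sum_univ_two]
  have top : ∀ k : SL2, mobiusS k OnePoint.infty = if (k.1 1 0 : ℝ) = 0 then OnePoint.infty
      else (((k.1 0 0 / k.1 1 0 : ℝ) : ℂ) : OnePoint ℂ) := fun _ => rfl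
  rw [top (g * h), top h, e00, e10]
  by_cases hc : h.1 1 0 = 0
  · have ha : h.1 0 0 ≠ 0 := by
      intro ha
      rw [ha, hc] at hh
      norm_num at hh
    rw [if_pos hc, top g, hc]
    simp only [mul_zero, add_zero, mul_eq_zero, ha, or_false]
    rw [mul_div_mul_right _ _ ha]
  · rw [if_neg hc]
    have coe : ∀ z : ℂ, mobiusS g (z : OnePoint ℂ) =
        if ((g.1 1 0 : ℂ) * z + (g.1 1 1 : ℂ)) = 0 then OnePoint.infty
        else ((mobiusC g z : ℂ) : OnePoint ℂ) := fun _ => rfl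
    have key : ((g.1 1 0 : ℂ) * ((h.1 0 0 / h.1 1 0 : ℝ) : ℂ) + (g.1 1 1 : ℂ)) =
        (((g.1 1 0 * h.1 0 0 + g.1 1 1 * h.1 1 0) / h.1 1 0 : ℝ) : ℂ) := by
      rw [add_div, mul_div_cancel_right₀ _ hc]
      push_cast
      ring
    have key' : ((g.1 0 0 : ℂ) * ((h.1 0 0 / h.1 1 0 : ℝ) : ℂ) + (g.1 0 1 : ℂ)) =
        (((g.1 0 0 * h.1 0 0 + g.1 0 1 * h.1 1 0) / h.1 1 0 : ℝ) : ℂ) := by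
      rw [add_div, mul_div_cancel_right₀ _ hc]
      push_cast
      ring
    rw [coe, mobiusC, key, key', ← Complex.ofReal_div, div_div_div_cancel_right₀ hc]
    simp only [Complex.ofReal_eq_zero, div_eq_zero_iff, hc, or_false]

theorem mobiusS_one_infty : mobiusS 1 OnePoint.infty = OnePoint.infty := by
  change (if ((1 : SL2).1 1 0 : ℝ) = 0 then OnePoint.infty else _) = _
  simp

theorem wordBar_val {r : ℕ} (a : Fin (2 * r)) :
    (wordBar a).1 = if a.1 < r then a.1 + r else a.1 - r := by
  have ha := a.2
  change (a.1 + r) % (2 * r) = _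
  split_ifs with h
  · exact Nat.mod_eq_of_lt (by omega)
  · rw [Nat.mod_eq_sub_mod (by omega), Nat.mod_eq_of_lt (by omega)]
    omega

theorem wordBar_wordBar {r : ℕ} (a : Fin (2 * r)) : wordBar (wordBar a) = a := by
  have ha := a.2
  apply Fin.ext
  rw [wordBar_val, wordBar_val]
  split_ifs <;> omega

theorem IsWord.tail {r : ℕ} {a : Fin (2 * r)} {w : List (Fin (2 * r))}
    (h : IsWord (a :: w)) : IsWord w :=
  List.IsChain.tail h

namespace Schottky

theorem wprod_cons (S : Schottky) (a : Fin (2 * S.r)) (w : List (Fin (2 * S.r))) :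
    S.wprod (a :: w) = S.g a * S.wprod w := by
  simp [wprod]

/-- The generator `γ_a` maps the complement of `D_ā` into the closure of `D_a`. -/
theorem mobiusS_mem_closure (S : Schottky) (a : Fin (2 * S.r)) {z : OnePoint ℂ}
    (hz : z ∉ (fun w : ℂ => (w : OnePoint ℂ)) '' S.D (wordBar a)) :
    mobiusS (S.g a) z ∈ (fun w : ℂ => (w : OnePoint ℂ)) '' closure (S.D a) :=
  (S.maps a).subset ⟨z, hz, rfl⟩

/-- Ping-pong: a nonempty word maps `∞` into the closed disc of its first letter. -/
theorem mobiusS_wprod_cons_infty (S : Schottky) (w : List (Fin (2 * S.r))) :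
    ∀ a, IsWord (a :: w) → mobiusS (S.wprod (a :: w)) OnePoint.infty ∈
      (fun w : ℂ => (w : OnePoint ℂ)) '' closure (S.D a) := by
  induction w with
  | nil =>
    intro a _
    rw [wprod_cons, mobiusS_mul_infty]
    apply S.mobiusS_mem_closure
    simp [wprod, mobiusS_one_infty]
  | cons b t ih =>
    intro a hw
    rw [wprod_cons, mobiusS_mul_infty]
    apply S.mobiusS_mem_closure
    obtain ⟨z, hz, hzeq⟩ := ih b hw.tail
    rw [← hzeq]
    rintro ⟨y, hy, hyz⟩
    obtain rfl : y = z := OnePoint.coe_injective hyz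
    have hab : a ≠ wordBar b := (List.isChain_cons_cons.mp hw).1
    have hne : wordBar a ≠ b := fun h => hab (by rw [← h, wordBar_wordBar])
    exact Set.disjoint_left.mp (S.disjoint _ _ hne) (subset_closure hy) hz

theorem wprod_cons_ne_one (S : Schottky) {a : Fin (2 * S.r)} {w : List (Fin (2 * S.r))}
    (hw : IsWord (a :: w)) : S.wprod (a :: w) ≠ 1 := by
  intro h
  obtain ⟨z, -, hz⟩ := S.mobiusS_wprod_cons_infty w a hw
  rw [h, mobiusS_one_infty] at hz
  exact OnePoint.coe_ne_infty z hz

theorem wprod_injOn (S : Schottky) (w : List (Fin (2 * S.r))) :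
    ∀ v, IsWord w → IsWord v → S.wprod w = S.wprod v → w = v := by
  induction w with
  | nil =>
    rintro (_ | ⟨b, v⟩) _ hv h
    · rfl
    · exact absurd h.symm (S.wprod_cons_ne_one hv)
  | cons a w ih =>
    rintro (_ | ⟨b, v⟩) hw hv h
    · exact absurd h (S.wprod_cons_ne_one hw)
    · obtain rfl : a = b := by
        by_contra hab
        obtain ⟨x, hx, hxe⟩ := S.mobiusS_wprod_cons_infty w a hw
        obtain ⟨y, hy, hye⟩ := S.mobiusS_wprod_cons_infty v b hv
        rw [h, ← hye] at hxe
        obtain rfl : x = y := OnePoint.coe_injective hxe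
        exact Set.disjoint_left.mp (S.disjoint _ _ hab) hx hy
      rw [wprod_cons, wprod_cons] at h
      rw [ih v hw.tail hv.tail (mul_left_cancel h)]

end Schottky

/-- The letter of `𝒜` encoding a free generator or its inverse. -/
def signedLetter {r : ℕ} (p : Fin r × Bool) : Fin (2 * r) :=
  bif p.2 then ⟨p.1.1, by have := p.1.2; omega⟩ else ⟨p.1.1 + r, by have := p.1.2; omega⟩

theorem isWord_map_signedLetter {r : ℕ} {L : List (Fin r × Bool)}
    (hL : FreeGroup.IsReduced L) : IsWord (L.map signedLetter) := by
  refine (List.isChain_map _).mpr (List.IsChain.imp ?_ hL)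
  rintro ⟨i, b⟩ ⟨j, c⟩ h heq
  have hi := i.2
  have hj := j.2
  have hval := congrArg Fin.val heq
  rw [wordBar_val] at hval
  have hij : i = j ∧ b ≠ c := by
    cases b <;> cases c <;> simp [signedLetter, Fin.ext_iff] at hval ⊢ <;> omega
  exact hij.2 (h hij.1)

theorem Schottky.wprod_map_signedLetter (S : Schottky) (L : List (Fin S.r × Bool)) :
    S.wprod (L.map signedLetter) =
      FreeGroup.lift (fun j : Fin S.r => S.g (signedLetter (j, true))) (FreeGroup.mk L) := by
  rw [FreeGroup.lift_mk, Schottky.wprod, List.map_map]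
  congr 1
  apply List.map_congr_left
  rintro ⟨j, b⟩ -
  cases b
  · have hbar : signedLetter (j, false) = wordBar (signedLetter (j, true)) := by
      apply Fin.ext
      rw [wordBar_val]
      simp [signedLetter]
    rw [Function.comp_apply, hbar, S.g_bar]
    rfl
  · rfl

/-- the encoding map `𝐚 ↦ γ_𝐚` is injective on words; consequently `Γ`
is free on `γ₁, …, γ_r`: the homomorphism from the free group on `r` generators sending the
`j`-th generator to `γ_j` is injective. -/
theorem stmt_14 (S : Schottky) :
    (∀ w v : List (Fin (2 * S.r)), IsWord w → IsWord v → S.wprod w = S.wprod v → w = v) ∧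
    Function.Injective
      ⇑(FreeGroup.lift (fun j : Fin S.r => S.g ⟨j.1, by have := j.2; omega⟩) :
        FreeGroup (Fin S.r) →* SL2) := by
  refine ⟨fun w v => S.wprod_injOn w v, (injective_iff_map_eq_one _).mpr fun x hx => ?_⟩
  change FreeGroup.lift (fun j : Fin S.r => S.g (signedLetter (j, true))) x = 1 at hx
  rw [← FreeGroup.mk_toWord (x := x), ← S.wprod_map_signedLetter] at hx
  have h := S.wprod_injOn _ [] (isWord_map_signedLetter FreeGroup.isReduced_toWord)
    List.isChain_nil hx
  exact FreeGroup.toWord_eq_nil_iff.mp (List.map_eq_nil_iff.mp h)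
end
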